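/- There exists a constant C > 0 such that for every integer n ≥ 1, ∫_{ℙ¹} |(d−1)·Σ_{m|n} μ(n/m)·log|F_m(λ)| − ((d−1)/d)·ν(n)·g_I(λ)| dω(λ) ≤ (2 log d)·σ₁(n) + C·σ₀(n). -/

import Mathlib

open MeasureTheory Real

/- STATEMENT 16:
There exists a constant C > 0 such that for every n ≥ 1,
∫_{ℙ¹} |(d−1)·Σ_{m|n} μ(n/m)·log|F_m(λ)| − ((d−1)/d)·ν(n)·g_I(λ)| dω(λ)
  ≤ (2 log d)·σ₁(n) + C·σ₀(n),
where ν(n) := Σ_{m|n} μ(n/m)·d^m, σ₀(n) := Σ_{m|n} 1, σ₁(n) := Σ_{m|n} m,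
g_I(λ) := lim_{n→∞} d^{−(n−1)}·(1/2)·log(1+|F_n(λ)|²), and ω is the normalized
Fubini–Study measure (∫ φ dω = (1/π)∫_ℂ φ(λ)(1+|λ|²)^{−2} dA(λ)). -/

noncomputable def fc (d : ℕ) (lam z : ℂ) : ℂ := z ^ d + lam

noncomputable def nu (d n : ℕ) : ℤ :=
  ∑ m ∈ n.divisors, ArithmeticFunction.moebius (n / m) * (d : ℤ) ^ m

theorem cov_lintegral {s : Set ℂ} (hs : MeasurableSet s) {φ φ' : ℂ → ℂ}
    (h : ∀ z ∈ s, HasDerivWithinAt φ (φ' z) s z) (hi : Set.InjOn φ s) (g : ℂ → ENNReal) :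
    ∫⁻ w in φ '' s, g w = ∫⁻ z in s, ‖φ' z‖ₑ ^ 2 * g (φ z) := by
  have h2 : ∀ z ∈ s, HasFDerivWithinAt φ
      (((ContinuousLinearMap.toSpanSingleton ℂ (φ' z)) : ℂ →L[ℂ] ℂ).restrictScalars ℝ) s z :=
    fun z hz => (h z hz).hasFDerivWithinAt.restrictScalars ℝ
  rw [lintegral_image_eq_lintegral_abs_det_fderiv_mul volume hs h2 hi]
  refine lintegral_congr fun z => ?_
  congr 1
  rw [ContinuousLinearMap.det]
  have : (((ContinuousLinearMap.restrictScalars ℝ (ContinuousLinearMap.toSpanSingleton ℂ (φ' z)))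
      : ℂ →L[ℝ] ℂ) : ℂ →ₗ[ℝ] ℂ) = ((ContinuousLinearMap.toSpanSingleton ℂ (φ' z) : ℂ →L[ℂ] ℂ) : ℂ →ₗ[ℂ] ℂ).restrictScalars ℝ := rfl
  rw [this, LinearMap.det_restrictScalars, ← ofReal_norm, ← ENNReal.ofReal_pow (norm_nonneg _)]
  simp [Complex.normSq_eq_norm_sq, Algebra.norm_complex_apply]

theorem polar_lintegral {g : ℂ → ENNReal} (hg : Measurable g) :
    ∫⁻ z, g z = ∫⁻ r in Set.Ioi (0:ℝ), ENNReal.ofReal r *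
      ∫⁻ θ in Set.Ioo (-π) π, g (r * Complex.exp (θ * Complex.I)) := by
  rw [← Complex.lintegral_comp_polarCoord_symm, polarCoord_target, Measure.volume_eq_prod,
    ← Measure.prod_restrict, lintegral_prod]
  · refine lintegral_congr fun r => ?_
    rw [← lintegral_const_mul]
    · refine lintegral_congr fun θ => ?_
      simp only [Complex.polarCoord_symm_apply, smul_eq_mul, Complex.exp_mul_I, Complex.ofReal_cos,
        Complex.ofReal_sin]
    · apply hg.comp
      fun_prop
  · refine Measurable.aemeasurable ?_
    simp only [Complex.polarCoord_symm_apply, smul_eq_mul]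
    refine Measurable.mul (by fun_prop) (hg.comp ?_)
    fun_prop

/-- polar coordinates for a radial function -/
theorem polar_radial {g : ℝ → ENNReal} (hg : Measurable g) :
    ∫⁻ z : ℂ, g ‖z‖ = ENNReal.ofReal (2 * π) * ∫⁻ r in Set.Ioi (0:ℝ), ENNReal.ofReal r * g r := by
  rw [polar_lintegral (by fun_prop), ← lintegral_const_mul _ (by fun_prop)]
  refine setLIntegral_congr_fun measurableSet_Ioi fun r hr => ?_
  have : ∀ θ : ℝ, ‖(r:ℂ) * Complex.exp (θ * Complex.I)‖ = r := fun θ => by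
    rw [norm_mul, Complex.norm_exp_ofReal_mul_I, mul_one, Complex.norm_real, Real.norm_of_nonneg hr.le]
  simp only [this, lintegral_const, Measure.restrict_apply, MeasurableSet.univ, Set.univ_inter,
    Real.volume_Ioo]
  rw [show π - -π = 2 * π by ring]
  ring

theorem circle_enorm_le (f : ℂ → ℂ) (c : ℂ) (r : ℝ) :
    ENNReal.ofReal (2 * π) * ‖circleAverage f c r‖ₑ ≤
      ∫⁻ θ in Set.Ioo (-π) π, ‖f (c + r * Complex.exp (θ * Complex.I))‖ₑ := by
  have h1 : circleAverage f c r = (2 * π)⁻¹ • ∫ θ in Set.Ioo (-π) π, f (c + r * Complex.exp (θ * Complex.I)) := by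
    rw [circleAverage]
    congr 1
    have hp : Function.Periodic (fun θ : ℝ => f (circleMap c r θ)) (2 * π) := by
      intro θ
      simp only [periodic_circleMap c r θ]
    have := hp.intervalIntegral_add_eq 0 (-π)
    rw [zero_add] at this
    rw [this, show -π + 2 * π = π by ring, intervalIntegral.integral_of_le (by linarith [pi_pos]),
      integral_Ioc_eq_integral_Ioo]
    rfl
  rw [h1, enorm_smul, ← mul_assoc]
  have : ENNReal.ofReal (2 * π) * ‖(2 * π)⁻¹‖ₑ = 1 := by
    rw [← ofReal_norm, ← ENNReal.ofReal_mul (by positivity), Real.norm_of_nonneg (by positivity),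
      mul_inv_cancel₀ (by positivity), ENNReal.ofReal_one]
  rw [this, one_mul]
  exact enorm_integral_le_lintegral_enorm _

theorem submean {h : ℂ → ℂ} {t : ℂ} {ρ : ℝ} (hρ : 0 < ρ)
    (hh : DifferentiableOn ℂ h (Metric.ball t ρ)) :
    ENNReal.ofReal (π * ρ ^ 2) * ‖h t‖ₑ ^ 2 ≤ ∫⁻ z in Metric.ball t ρ, ‖h z‖ₑ ^ 2 := by
  classical
  set G : ℂ → ENNReal := fun z => (Metric.ball t ρ).indicator (fun z => ‖h z‖ₑ ^ 2) z with hG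
  have hGm : Measurable G := by
    refine measurable_of_restrict_of_restrict_compl (s := Metric.ball t ρ) measurableSet_ball ?_ ?_
    · have : (Metric.ball t ρ).domRestrict G = fun z : Metric.ball t ρ => ‖(Metric.ball t ρ).domRestrict h z‖ₑ ^ 2 := by
        ext z; simp [hG]
      rw [this]
      have := hh.continuousOn.domRestrict.measurable
      fun_prop
    · have : (Metric.ball t ρ)ᶜ.domRestrict G = fun _ => 0 := by
        ext z
        have := z.2
        simp only [hG, Set.domRestrict_apply]
        exact Set.indicator_of_notMem this _
      rw [this]; exact measurable_const
  rw [← lintegral_indicator measurableSet_ball]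
  change _ ≤ ∫⁻ z, G z
  rw [← lintegral_add_left_eq_self G t, polar_lintegral (by fun_prop)]
  calc ENNReal.ofReal (π * ρ ^ 2) * ‖h t‖ₑ ^ 2
      = ∫⁻ r in Set.Ioo 0 ρ, ENNReal.ofReal r * (ENNReal.ofReal (2 * π) * ‖h t‖ₑ ^ 2) := by
        rw [lintegral_mul_const _ (by fun_prop), ← mul_assoc]
        congr 1
        rw [← ofReal_integral_eq_lintegral_ofReal, ← integral_Ioc_eq_integral_Ioo,
          ← intervalIntegral.integral_of_le hρ.le, integral_id, ← ENNReal.ofReal_mul]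
        · congr 1; ring
        · nlinarith [sq_nonneg ρ]
        · exact (continuous_id.integrableOn_Icc (a := 0) (b := ρ)).mono_set Set.Ioo_subset_Icc_self
        · exact (ae_restrict_iff' measurableSet_Ioo).2 (.of_forall fun r hr => hr.1.le)
    _ ≤ ∫⁻ r in Set.Ioo 0 ρ, ENNReal.ofReal r *
      ∫⁻ θ in Set.Ioo (-π) π, G (t + r * Complex.exp (θ * Complex.I)) := by
        refine setLIntegral_mono' measurableSet_Ioo fun r hr => ?_
        gcongr
        have h1 : circleAverage (fun z => h z ^ 2) t r = h t ^ 2 := by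
          refine DiffContOnCl.circleAverage ?_
          rw [abs_of_pos hr.1]
          refine DifferentiableOn.diffContOnCl ?_
          rw [closure_ball _ hr.1.ne']
          exact (hh.pow 2).mono (Metric.closedBall_subset_ball hr.2)
        have h2 := circle_enorm_le (fun z => h z ^ 2) t r
        rw [h1, enorm_pow] at h2
        refine h2.trans (le_of_eq ?_)
        refine lintegral_congr fun θ => ?_
        rw [enorm_pow]
        simp only [hG]
        rw [Set.indicator_of_mem]
        rw [Metric.mem_ball, dist_eq_norm, add_sub_cancel_left, norm_mul,
          Complex.norm_exp_ofReal_mul_I, mul_one, Complex.norm_real, Real.norm_of_nonneg hr.1.le]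
        exact hr.2
    _ ≤ _ := lintegral_mono_set Set.Ioo_subset_Ioi_self

theorem disc_log {h : ℂ → ℂ} {δ : ℝ} (hδ : 0 < δ)
    (hh : DifferentiableOn ℂ h (Metric.ball 0 δ)) :
    ∫⁻ t in Metric.ball (0:ℂ) δ, ‖h t‖ₑ ^ 2 * ENNReal.ofReal (Real.log (δ / ‖t‖)) ≤
      5 * ∫⁻ t in Metric.ball (0:ℂ) δ, ‖h t‖ₑ ^ 2 := by
  set I := ∫⁻ t in Metric.ball (0:ℂ) δ, ‖h t‖ₑ ^ 2 with hI
  have hpt : ∀ t ∈ Metric.ball (0:ℂ) δ, ‖h t‖ₑ ^ 2 * ENNReal.ofReal (Real.log (δ / ‖t‖)) ≤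
      ‖h t‖ₑ ^ 2 + I / ENNReal.ofReal (π * (δ/2)^2) *
        (Set.Iio (δ/2)).indicator (fun r => ENNReal.ofReal (δ / r)) ‖t‖ := by
    intro t ht
    by_cases hc : ‖t‖ < δ / 2
    · rw [Set.indicator_of_mem (by exact hc)]
      refine le_add_left ?_
      refine mul_le_mul' ?_ ?_
      · rw [ENNReal.le_div_iff_mul_le]
        · rw [mul_comm]
          refine (submean (by positivity) (hh.mono ?_)).trans (lintegral_mono_set ?_)
          all_goals
            intro z hz
            rw [Metric.mem_ball, dist_eq_norm] at hz
            rw [Metric.mem_ball, dist_zero_right]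
            have := norm_add_le (z - t) t
            rw [sub_add_cancel] at this
            linarith
        · left
          rw [ne_eq, ENNReal.ofReal_eq_zero, not_le]; positivity
        · left; exact ENNReal.ofReal_ne_top
      · exact ENNReal.ofReal_le_ofReal (Real.log_le_self (by positivity))
    · refine le_add_right ?_
      conv_rhs => rw [← mul_one (‖h t‖ₑ ^ 2)]
      gcongr
      rw [← ENNReal.ofReal_one]
      apply ENNReal.ofReal_le_ofReal
      push Not at hc
      have ht0 : 0 < ‖t‖ := by linarith
      have : δ / ‖t‖ ≤ 2 := by rw [div_le_iff₀ ht0]; linarith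
      have h2 := Real.log_le_log (by positivity) this
      have := Real.log_two_lt_d9
      linarith
  refine (setLIntegral_mono' measurableSet_ball hpt).trans ?_
  have hm : Measurable ((Set.Iio (δ/2)).indicator (fun r => ENNReal.ofReal (δ / r))) :=
    Measurable.indicator (by fun_prop) measurableSet_Iio
  rw [lintegral_add_right _ (by fun_prop), lintegral_const_mul _ (by fun_prop)]
  have h3 : ∫⁻ t in Metric.ball (0:ℂ) δ, (Set.Iio (δ/2)).indicator (fun r => ENNReal.ofReal (δ / r)) ‖t‖
      ≤ ENNReal.ofReal (π * δ ^ 2) := by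
    refine (setLIntegral_le_lintegral _ _).trans ?_
    rw [polar_radial hm]
    have : ∫⁻ r in Set.Ioi (0:ℝ), ENNReal.ofReal r * (Set.Iio (δ/2)).indicator (fun r => ENNReal.ofReal (δ / r)) r
        ≤ ∫⁻ r in Set.Ioi (0:ℝ), (Set.Iio (δ/2)).indicator (fun r => ENNReal.ofReal δ) r := by
      refine setLIntegral_mono' measurableSet_Ioi fun r hr => ?_
      by_cases hc : r ∈ Set.Iio (δ/2)
      · rw [Set.indicator_of_mem hc, Set.indicator_of_mem hc, ← ENNReal.ofReal_mul (le_of_lt hr)]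
        rw [mul_div_cancel₀ _ (ne_of_gt hr)]
      · rw [Set.indicator_of_notMem hc]; simp
    refine (mul_le_mul_right this _).trans ?_
    rw [setLIntegral_indicator measurableSet_Iio, setLIntegral_const, Set.inter_comm, Set.Ioi_inter_Iio,
      Real.volume_Ioo, ← ENNReal.ofReal_mul (by positivity), ← ENNReal.ofReal_mul (by positivity)]
    apply ENNReal.ofReal_le_ofReal
    apply le_of_eq; ring
  calc I + I / ENNReal.ofReal (π * (δ/2)^2) * _ ≤ I + I / ENNReal.ofReal (π * (δ/2)^2) * ENNReal.ofReal (π * δ ^ 2) := by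
        gcongr
    _ = I + I * 4 := by
        congr 1
        rw [div_eq_mul_inv, mul_assoc, mul_comm _ (ENNReal.ofReal (π * δ ^ 2)), ← div_eq_mul_inv,
          ← ENNReal.ofReal_div_of_pos (by positivity)]
        congr 1
        rw [show π * δ ^ 2 / (π * (δ / 2) ^ 2) = 4 by field_simp; norm_num]
        simp
    _ = 5 * I := by ring

open Polynomial in
theorem poly_branch (P : ℂ[X]) {δ : ℝ} (hP : ∀ x, ‖P.eval x‖ < δ → P.derivative.eval x ≠ 0)
    {x₀ : ℂ} (hx : ‖P.eval x₀‖ < δ) :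
    ∃ φ : ℂ → ℂ, φ (P.eval x₀) = x₀ ∧ ContinuousOn φ (Metric.ball 0 δ) ∧
      (∀ t ∈ Metric.ball (0:ℂ) δ, P.eval (φ t) = t) ∧
      (∀ ψ : ℂ → ℂ, ψ (P.eval x₀) = x₀ → ContinuousOn ψ (Metric.ball 0 δ) →
        (∀ t ∈ Metric.ball (0:ℂ) δ, P.eval (ψ t) = t) → Set.EqOn ψ φ (Metric.ball 0 δ)) := by
  classical
  have hδ : 0 < δ := (norm_nonneg _).trans_lt hx
  have hx' : P.eval x₀ ∈ Metric.ball (0:ℂ) δ := by simpa using hx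
  have hcv : Convex ℝ (Metric.ball (0:ℂ) δ) := convex_ball _ _
  have : ContractibleSpace (Metric.ball (0:ℂ) δ) := hcv.contractibleSpace ⟨_, hx'⟩
  have : LocallyPathConnectedSpace (Metric.ball (0:ℂ) δ) := Metric.isOpen_ball.locallyPathConnectedSpace
  have hs : ∀ a : Metric.ball (0:ℂ) δ, (⟨Subtype.val, continuous_subtype_val⟩ : C(Metric.ball (0:ℂ) δ, ℂ)) a ∈
      (P.eval '' {k | P.derivative.eval k = 0})ᶜ := by
    rintro ⟨a, ha⟩ ⟨k, hk, hka⟩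
    refine hP k ?_ hk
    change P.eval k = a at hka
    rw [hka]; simpa using ha
  obtain ⟨Φ, ⟨h1, h2⟩, h3⟩ := P.isCoveringMapOn_eval.existsUnique_continuousMap_lifts
    (⟨Subtype.val, continuous_subtype_val⟩ : C(Metric.ball (0:ℂ) δ, ℂ)) (a₀ := ⟨_, hx'⟩) (e₀ := x₀) rfl hs
  have hval : ∀ t (ht : t ∈ Metric.ball (0:ℂ) δ), (fun t => if ht : t ∈ Metric.ball (0:ℂ) δ then Φ ⟨t, ht⟩ else 0) t = Φ ⟨t, ht⟩ :=
    fun t ht => by simp only [ht, dite_true]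
  refine ⟨fun t => if ht : t ∈ Metric.ball (0:ℂ) δ then Φ ⟨t, ht⟩ else 0, ?_, ?_, ?_, ?_⟩
  · rw [hval _ hx']; exact h1
  · rw [continuousOn_iff_continuous_domRestrict]
    convert Φ.continuous using 1
    ext t
    simp only [Set.domRestrict_apply]
    exact hval _ t.2
  · intro t ht
    rw [hval _ ht]
    exact congrFun h2 ⟨t, ht⟩
  · intro ψ e1 e2 e3 t ht
    have := h3 ⟨(Metric.ball (0:ℂ) δ).domRestrict ψ, e2.domRestrict⟩ ⟨e1, by ext t; exact e3 t t.2⟩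
    rw [hval _ ht, ← this]
    rfl

open Polynomial in
theorem poly_log (P : ℂ[X]) {δ : ℝ} (hδ : 0 < δ) (hP : ∀ x, ‖P.eval x‖ < δ → P.derivative.eval x ≠ 0) :
    ∫⁻ x in {x | ‖P.eval x‖ < δ}, ENNReal.ofReal (Real.log (δ / ‖P.eval x‖)) ≤
      5 * volume {x : ℂ | ‖P.eval x‖ < δ} := by
  classical
  have hP0 : P ≠ 0 := by
    rintro rfl
    exact hP 0 (by simpa using hδ) (by simp)
  set B := Metric.ball (0:ℂ) δ with hB
  have hB0 : (0:ℂ) ∈ B := by simpa [hB] using hδ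
  have hex : ∀ a : ℂ, ∃ φ : ℂ → ℂ, P.eval a = 0 → (φ 0 = a ∧ ContinuousOn φ B ∧
      (∀ t ∈ B, P.eval (φ t) = t)) := by
    intro a
    by_cases ha : P.eval a = 0
    · obtain ⟨φ, h1, h2, h3, -⟩ := poly_branch P hP (x₀ := a) (by simpa [ha] using hδ)
      rw [ha] at h1
      exact ⟨φ, fun _ => ⟨h1, h2, h3⟩⟩
    · exact ⟨0, fun h => absurd h ha⟩
  choose φ hφ using hex
  set S := P.roots.toFinset with hS
  have hmem : ∀ a, a ∈ S ↔ P.eval a = 0 := fun a => by simp [hS, hP0]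
  have hder : ∀ a ∈ S, ∀ t ∈ B, HasDerivAt (φ a) (P.derivative.eval (φ a t))⁻¹ t := by
    intro a ha t ht
    obtain ⟨h1, h2, h3⟩ := hφ a ((hmem a).1 ha)
    refine HasDerivAt.of_local_left_inverse (f := fun x => P.eval x) (h2.continuousAt (Metric.isOpen_ball.mem_nhds ht)) (P.hasDerivAt _) ?_ ?_
    · apply hP; rw [h3 t ht]; simpa [hB] using ht
    · filter_upwards [Metric.isOpen_ball.mem_nhds ht] with y hy using h3 y hy
  have hinj : ∀ a ∈ S, Set.InjOn (φ a) B := by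
    intro a ha s hs t ht hst
    obtain ⟨h1, h2, h3⟩ := hφ a ((hmem a).1 ha)
    rw [← h3 s hs, ← h3 t ht, hst]
  have hcover : {x : ℂ | ‖P.eval x‖ < δ} ⊆ ⋃ a ∈ S, φ a '' B := by
    intro x hx
    obtain ⟨ψ, h1, h2, h3, h4⟩ := poly_branch P hP hx
    have ha : P.eval (ψ 0) = 0 := h3 0 hB0
    obtain ⟨g1, g2, g3⟩ := hφ (ψ 0) ha
    obtain ⟨χ, k1, k2, k3, k4⟩ := poly_branch P hP (x₀ := ψ 0) (by simpa [ha] using hδ)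
    rw [ha] at k1 k4
    have e1 := k4 _ g1 g2 g3
    have e2 := k4 ψ rfl h2 h3
    have hxB : P.eval x ∈ B := by simpa [hB] using hx
    simp only [Set.mem_iUnion]
    refine ⟨ψ 0, (hmem _).2 ha, P.eval x, hxB, ?_⟩
    rw [e1 hxB, ← e2 hxB, h1]
  have hsub : (⋃ a ∈ S, φ a '' B) ⊆ {x : ℂ | ‖P.eval x‖ < δ} := by
    intro x hx
    simp only [Set.mem_iUnion] at hx
    obtain ⟨a, ha, t, ht, rfl⟩ := hx
    obtain ⟨h1, h2, h3⟩ := hφ a ((hmem a).1 ha)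
    rw [Set.mem_setOf_eq, h3 t ht]; simpa [hB] using ht
  have heq := hcover.antisymm hsub
  have hdisj : (S : Set ℂ).PairwiseDisjoint (fun a => φ a '' B) := by
    intro a ha b hb hab
    rw [Function.onFun, Set.disjoint_left]
    rintro _ ⟨s, hs, rfl⟩ ⟨t, ht, hst⟩
    obtain ⟨h1, h2, h3⟩ := hφ a ((hmem a).1 ha)
    obtain ⟨k1, k2, k3⟩ := hφ b ((hmem b).1 hb)
    have : t = s := by rw [← h3 s hs, ← k3 t ht, hst]
    subst this
    have hx : ‖P.eval (φ a t)‖ < δ := by rw [h3 t ht]; simpa [hB] using ht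
    obtain ⟨ψ, -, -, -, h4⟩ := poly_branch P hP hx
    rw [h3 t ht] at h4
    have e1 := h4 _ rfl h2 h3
    have e2 := h4 _ hst k2 k3
    apply hab
    rw [← h1, ← k1, e1 hB0, e2 hB0]
  have hmeas : ∀ a ∈ S, MeasurableSet (φ a '' B) := by
    intro a ha
    obtain ⟨h1, h2, h3⟩ := hφ a ((hmem a).1 ha)
    exact measurableSet_ball.image_of_continuousOn_injOn h2 (hinj a ha)
  rw [heq]
  rw [measure_biUnion_finset hdisj hmeas, Finset.mul_sum]
  rw [lintegral_biUnion_finset hdisj hmeas]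
  refine Finset.sum_le_sum fun a ha => ?_
  have hd : ∀ z ∈ B, HasDerivWithinAt (φ a) (P.derivative.eval (φ a z))⁻¹ B z :=
    fun z hz => (hder a ha z hz).hasDerivWithinAt
  rw [← setLIntegral_one, cov_lintegral measurableSet_ball hd (hinj a ha),
    cov_lintegral measurableSet_ball hd (hinj a ha)]
  obtain ⟨h1, h2, h3⟩ := hφ a ((hmem a).1 ha)
  have hdd : DifferentiableOn ℂ (fun z => (P.derivative.eval (φ a z))⁻¹) B := by
    have : DifferentiableOn ℂ (φ a) B := fun z hz => (hder a ha z hz).differentiableAt.differentiableWithinAt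
    refine DifferentiableOn.inv ?_ ?_
    · exact P.derivative.differentiable.comp_differentiableOn this
    · intro z hz
      apply hP; rw [h3 z hz]; simpa [hB] using hz
  simp only [mul_one]
  refine le_trans (le_of_eq ?_) (disc_log hδ hdd)
  refine setLIntegral_congr_fun measurableSet_ball fun t ht => ?_
  simp only [h3 t ht]

theorem push_ineq {d : ℕ} (hd : 1 < d) {ζ : ℂ} (hζ : IsPrimitiveRoot ζ d) (lam : ℂ)
    {V : Set ℂ} (hV : MeasurableSet V) {g G : ℂ → ENNReal} (hg : Measurable g)
    (h : ∀ w : ℂ, w ≠ 0 → w ^ d + lam ∈ V →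
      ‖(d : ℂ) * w ^ (d - 1)‖ₑ ^ 2 * G (w ^ d + lam) ≤ ∑ k ∈ Finset.range d, g (ζ ^ k * w)) :
    ∫⁻ z in V, G z ≤ ∫⁻ w in {w | w ^ d + lam ∈ V}, g w := by
  have hd0 : d ≠ 0 := by omega
  have hζ0 : ζ ≠ 0 := hζ.ne_zero hd0
  set V' : Set ℂ := {u | u + lam ∈ V} ∩ Complex.slitPlane with hV'
  have hV'm : MeasurableSet V' :=
    (measurableSet_preimage (by fun_prop : Measurable fun u : ℂ => u + lam) hV).inter
      Complex.isOpen_slitPlane.measurableSet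
  set ψ : ℂ → ℂ := fun u => u ^ ((d:ℂ)⁻¹) with hψ
  have hψd : ∀ u, ψ u ^ d = u := fun u => Complex.cpow_nat_inv_pow u hd0
  set ψ' : ℂ → ℂ := fun u => (d:ℂ)⁻¹ * u ^ ((d:ℂ)⁻¹ - 1) with hψ'
  have hder : ∀ u ∈ Complex.slitPlane, HasDerivAt ψ (ψ' u) u := by
    intro u hu
    have := (hasDerivAt_id u).cpow_const (c := (d:ℂ)⁻¹) hu
    simpa [hψ, hψ'] using this
  have hmul : ∀ u ∈ Complex.slitPlane, ψ' u * ((d : ℂ) * ψ u ^ (d - 1)) = 1 := by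
    intro u hu
    have h1 := ((hder u hu).pow d)
    have h2 : HasDerivAt (fun u => ψ u ^ d) 1 u := by
      simp only [hψd]; exact hasDerivAt_id u
    have := h1.unique h2
    rw [← this]; ring
  have hne : ∀ u ∈ V', ψ u ≠ 0 := by
    intro u hu h0
    have := hψd u
    rw [h0, zero_pow hd0] at this
    exact Complex.slitPlane_ne_zero hu.2 this.symm
  have e1 : ∫⁻ z in V, G z = ∫⁻ u in V', G (u + lam) := by
    rw [← lintegral_indicator hV, ← lintegral_indicator hV'm,
      ← lintegral_add_right_eq_self _ lam]
    refine lintegral_congr_ae ?_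
    have : (∀ᵐ u : ℂ, u ∈ Complex.slitPlane) := by
      have h0 : volume ((LinearMap.ker Complex.imLm : Submodule ℝ ℂ) : Set ℂ) = 0 := by
        refine Measure.addHaar_submodule _ _ fun ht => ?_
        have : Complex.I ∈ LinearMap.ker Complex.imLm := by rw [ht]; trivial
        simp at this
      refine measure_mono_null (fun u hu => ?_) h0
      simp only [SetLike.mem_coe, LinearMap.mem_ker, Complex.imLm_coe]
      by_contra hne
      exact hu (Or.inr hne)
    filter_upwards [this] with u hu
    by_cases huV : u + lam ∈ V
    · rw [Set.indicator_of_mem huV, Set.indicator_of_mem (show u ∈ V' from ⟨huV, hu⟩)]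
    · rw [Set.indicator_of_notMem huV, Set.indicator_of_notMem (fun h : u ∈ V' => huV h.1)]
  rw [e1]
  have hζd : ∀ k, (ζ ^ k) ^ d = 1 := fun k => by rw [← pow_mul, mul_comm, pow_mul, hζ.pow_eq_one, one_pow]
  have hnz : ∀ k, ‖ζ ^ k‖ₑ = 1 := fun k => by
    rw [← ofReal_norm, Complex.norm_eq_one_of_pow_eq_one (hζd k) hd0, ENNReal.ofReal_one]
  calc ∫⁻ u in V', G (u + lam) ≤ ∫⁻ u in V', ∑ k ∈ Finset.range d, ‖ψ' u‖ₑ ^ 2 * g (ζ ^ k * ψ u) := by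
        refine setLIntegral_mono' hV'm fun u hu => ?_
        have h1 := h (ψ u) (hne u hu) (by rw [hψd]; exact hu.1)
        rw [hψd] at h1
        calc G (u + lam) = ‖ψ' u‖ₑ ^ 2 * (‖(d : ℂ) * ψ u ^ (d - 1)‖ₑ ^ 2 * G (u + lam)) := by
              rw [← mul_assoc, ← mul_pow, ← enorm_mul, hmul u hu.2]; simp
          _ ≤ ‖ψ' u‖ₑ ^ 2 * ∑ k ∈ Finset.range d, g (ζ ^ k * ψ u) := by gcongr
          _ = _ := by rw [Finset.mul_sum]
    _ = ∑ k ∈ Finset.range d, ∫⁻ u in V', ‖ψ' u‖ₑ ^ 2 * g (ζ ^ k * ψ u) := by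
        refine lintegral_finsetSum _ fun k _ => ?_
        have : Measurable ψ := by fun_prop
        have : Measurable ψ' := by fun_prop
        fun_prop
    _ = ∑ k ∈ Finset.range d, ∫⁻ w in (fun u => ζ ^ k * ψ u) '' V', g w := by
        refine Finset.sum_congr rfl fun k _ => ?_
        rw [cov_lintegral (φ' := fun u => ζ ^ k * ψ' u) hV'm]
        · refine lintegral_congr fun u => ?_
          rw [enorm_mul (ζ ^ k), hnz, one_mul]
        · intro u hu
          exact ((hder u hu.2).const_mul _).hasDerivWithinAt
        · intro u hu v hv huv
          have := congrArg (· ^ d) huv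
          simpa [mul_pow, hζd, hψd] using this
    _ = ∫⁻ w in ⋃ k ∈ Finset.range d, (fun u => ζ ^ k * ψ u) '' V', g w := by
        rw [lintegral_biUnion_finset]
        · intro k hk l hl hkl
          refine Set.disjoint_left.2 ?_
          rintro _ ⟨u, hu, rfl⟩ ⟨v, hv, huv⟩
          have h2 := congrArg (· ^ d) huv
          simp only [mul_pow, hζd, hψd, one_mul] at h2
          subst h2
          have := mul_right_cancel₀ (hne v hv) huv
          exact hkl (hζ.pow_inj (Finset.mem_range.1 hl) (Finset.mem_range.1 hk) this).symm
        · intro k hk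
          refine hV'm.image_of_continuousOn_injOn ?_ ?_
          · exact fun u hu => ((hder u hu.2).const_mul _).continuousAt.continuousWithinAt
          · intro u hu v hv huv
            have := congrArg (· ^ d) huv
            simpa [mul_pow, hζd, hψd] using this
    _ ≤ _ := by
        refine lintegral_mono_set ?_
        simp only [Set.iUnion_subset_iff]
        rintro k hk _ ⟨u, hu, rfl⟩
        have : (ζ ^ k * ψ u) ^ d + lam ∈ V := by
          rw [mul_pow, hζd, hψd, one_mul]; exact hu.1
        exact this

theorem root_sum {d : ℕ} (hd : 1 < d) {ζ : ℂ} (hζ : IsPrimitiveRoot ζ d) {w x : ℂ}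
    (hwx : w ^ d - x ^ d ≠ 0) :
    ∑ k ∈ Finset.range d, (ζ ^ k) ^ 2 / (ζ ^ k * w - x) = d * x * w ^ (d - 2) / (w ^ d - x ^ d) := by
  have hζd : ∀ k, (ζ ^ k) ^ d = 1 := fun k => by rw [← pow_mul, mul_comm, pow_mul, hζ.pow_eq_one, one_pow]
  have h1 : ∀ k ∈ Finset.range d, (ζ ^ k) ^ 2 / (ζ ^ k * w - x) =
      (∑ i ∈ Finset.range d, (w ^ i * x ^ (d - 1 - i)) * (ζ ^ (i + 2)) ^ k) / (w ^ d - x ^ d) := by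
    intro k _
    have h2 := (Commute.all (ζ ^ k * w) x).geom_sum₂_mul d
    rw [mul_pow, hζd, one_mul] at h2
    have h3 : ζ ^ k * w - x ≠ 0 := by
      intro h; rw [h, mul_zero] at h2; exact hwx h2.symm
    rw [div_eq_div_iff h3 hwx, ← h2, ← mul_assoc, Finset.mul_sum]
    congr 1
    refine Finset.sum_congr rfl fun i _ => ?_
    rw [mul_pow, ← pow_mul, ← pow_mul, ← pow_mul]
    rw [show (i + 2) * k = k * 2 + k * i by ring, pow_add]
    ring
  rw [Finset.sum_congr rfl h1, ← Finset.sum_div]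
  congr 1
  rw [Finset.sum_comm]
  rw [Finset.sum_eq_single (d - 2)]
  · rw [← Finset.mul_sum, show d - 2 + 2 = d by omega, hζ.pow_eq_one, show d - 1 - (d - 2) = 1 by omega]
    simp
    ring
  · intro i hi hne
    rw [← Finset.mul_sum]
    have hi' := Finset.mem_range.1 hi
    have : ζ ^ (i + 2) ≠ 1 := by
      intro h
      have := (hζ.pow_eq_one_iff_dvd _).1 h
      obtain ⟨c, hc⟩ := this
      rcases c with _ | _ | c
      · omega
      · omega
      · nlinarith
    have h4 : (∑ k ∈ Finset.range d, (ζ ^ (i + 2)) ^ k) * (ζ ^ (i + 2) - 1) = 0 := by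
      rw [geom_sum_mul, hζd, sub_self]
    rcases mul_eq_zero.1 h4 with h | h
    · rw [h, mul_zero]
    · exact absurd (sub_eq_zero.1 h) this
  · intro h; exact absurd (Finset.mem_range.2 (by omega)) h

/-- the quadratic differential identity -/
theorem qd_identity {d : ℕ} (hd : 1 < d) {ζ : ℂ} (hζ : IsPrimitiveRoot ζ d) {lam : ℂ}
    {F ρ : ℕ → ℂ} (hF1 : F 1 = lam) (hF : ∀ i, F (i + 1) = F i ^ d + lam) {n : ℕ}
    (hρn : ρ (n + 1) = 1) (hρ : ∀ i, 1 ≤ i → i ≤ n → ρ i = d * F i ^ (d - 1) * ρ (i + 1))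
    (hsum : ∑ i ∈ Finset.range (n + 1), ρ (i + 1) = 0) {w : ℂ} (hw : w ≠ 0)
    (hz : ∀ i ≤ n + 1, w ^ d + lam - F (i + 1) ≠ 0) :
    ∑ k ∈ Finset.range d, (ζ ^ k) ^ 2 * ∑ i ∈ Finset.range (n + 1), ρ (i + 1) / (ζ ^ k * w - F (i + 1))
    = (d * w ^ (d - 1)) ^ 2 * ((∑ i ∈ Finset.range (n + 1), ρ (i + 1) / (w ^ d + lam - F (i + 1))) +
      (F (n + 1) / d) / ((w ^ d + lam - F 1) * (w ^ d + lam - F (n + 2)))) := by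
  have hd0 : (d : ℂ) ≠ 0 := by exact_mod_cast (by omega : d ≠ 0)
  set z := w ^ d + lam with hzdef
  have hwd : ∀ i, w ^ d - F i ^ d = z - F (i + 1) := fun i => by rw [hF, hzdef]; ring
  have hw2 : (d * w ^ (d - 1)) ^ 2 = d ^ 2 * w ^ (d - 2) * w ^ d := by
    rw [mul_pow, ← pow_mul, mul_assoc, ← pow_add]; congr 2; omega
  have hwd1 : z - F 1 = w ^ d := by rw [hF1, hzdef]; ring
  have hwd0 : w ^ d ≠ 0 := pow_ne_zero _ hw
  have hL : ∑ k ∈ Finset.range d, (ζ ^ k) ^ 2 * ∑ i ∈ Finset.range (n + 1), ρ (i + 1) / (ζ ^ k * w - F (i + 1))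
      = ∑ i ∈ Finset.range (n + 1), ρ (i + 1) * (d * F (i + 1) * w ^ (d - 2) / (z - F (i + 2))) := by
    simp_rw [Finset.mul_sum]
    rw [Finset.sum_comm]
    refine Finset.sum_congr rfl fun i hi => ?_
    have hi' := Finset.mem_range.1 hi
    rw [← hwd, ← root_sum hd hζ, Finset.mul_sum]
    · refine Finset.sum_congr rfl fun k _ => by ring
    · rw [hwd]; exact hz (i + 1) (by omega)
  rw [hL, Finset.sum_range_succ, hρn]
  have hterm : ∀ i ∈ Finset.range n, ρ (i + 1) * (d * F (i + 1) * w ^ (d - 2) / (z - F (i + 2))) =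
      d ^ 2 * w ^ (d - 2) * w ^ d * (ρ (i + 2) / (z - F (i + 2))) - d ^ 2 * w ^ (d - 2) * ρ (i + 2) := by
    intro i hi
    have hi' := Finset.mem_range.1 hi
    have hz' := hz (i + 1) (by omega)
    rw [hρ (i + 1) (by omega) (by omega)]
    have hFd : F (i + 1) ^ (d - 1) * F (i + 1) = w ^ d - (z - F (i + 2)) := by
      rw [← hwd, ← pow_succ, show d - 1 + 1 = d by omega]; ring
    rw [show d * F (i + 1) ^ (d - 1) * ρ (i + 1 + 1) * (d * F (i + 1) * w ^ (d - 2) / (z - F (i + 2)))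
      = (F (i + 1) ^ (d - 1) * F (i + 1)) * (d ^ 2 * ρ (i + 2) * w ^ (d - 2)) / (z - F (i + 2)) by ring, hFd]
    field_simp
  rw [Finset.sum_congr rfl hterm, Finset.sum_sub_distrib, ← Finset.mul_sum, ← Finset.mul_sum, hw2,
    Finset.sum_range_succ' (fun i => ρ (i + 1) / (z - F (i + 1)))]
  rw [Finset.sum_range_succ'] at hsum
  rw [show ∑ i ∈ Finset.range n, ρ (i + 2) = - ρ 1 from eq_neg_of_add_eq_zero_left hsum]
  simp only [zero_add, hwd1]
  have hz' := hz (n + 1) le_rfl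
  have e : ∀ i, i + 1 + 1 = i + 2 := fun i => rfl
  simp only [e] at hz' ⊢
  field_simp
  ring

theorem circleAverage_term {a : ℂ} {τ : ℝ} (hτ : 0 < τ) (ha : ‖a‖ ≠ τ) :
    circleAverage (fun z => z / (z - a)) 0 τ = if ‖a‖ < τ then 1 else 0 := by
  rw [circleAverage_eq_circleIntegral hτ.ne']
  have : (∮ z in C(0, τ), (z - 0)⁻¹ • (z / (z - a))) = ∮ z in C(0, τ), (z - a)⁻¹ := by
    refine circleIntegral.integral_congr hτ.le fun z hz => ?_
    have hz0 : z ≠ 0 := by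
      rintro rfl; simp at hz; exact hτ.ne hz
    simp only [sub_zero, smul_eq_mul]
    field_simp
  rw [this]
  split_ifs with h
  · rw [circleIntegral.integral_sub_inv_of_mem_ball (by simpa using h), smul_eq_mul, inv_mul_cancel₀]
    simp [Real.pi_ne_zero]
  · have hlt : τ < ‖a‖ := lt_of_le_of_ne (not_lt.1 h) ha.symm
    have : (∮ z in C(0, τ), (z - a)⁻¹) = 0 := by
      refine Complex.circleIntegral_eq_zero_of_differentiable_on_off_countable hτ.le
        Set.countable_empty ?_ ?_
      · intro z hz
        have : z - a ≠ 0 := by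
          intro h; rw [sub_eq_zero.1 h] at hz; simp at hz; linarith
        have hc : ContinuousAt (fun z => (z - a)⁻¹) z := by fun_prop (disch := assumption)
        exact hc.continuousWithinAt
      · intro z hz
        have : z - a ≠ 0 := by
          intro h
          have := hz.1
          rw [sub_eq_zero.1 h] at this; simp at this; linarith
        fun_prop (disch := assumption)
    rw [this, smul_zero]

theorem circleAverage_q {n : ℕ} (ρ a : ℕ → ℂ) {τ : ℝ} (hτ : 0 < τ) (ha : ∀ i < n, ‖a i‖ ≠ τ) :
    circleAverage (fun z => z * ∑ i ∈ Finset.range n, ρ i / (z - a i)) 0 τ =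
      ∑ i ∈ Finset.range n with ‖a i‖ < τ, ρ i := by
  have h1 : (fun z => z * ∑ i ∈ Finset.range n, ρ i / (z - a i)) =
      fun z => ∑ i ∈ Finset.range n, (ρ i • fun z => z / (z - a i)) z := by
    ext z; rw [Finset.mul_sum]; refine Finset.sum_congr rfl fun i _ => ?_
    simp only [Pi.smul_apply, smul_eq_mul]; ring
  rw [h1, circleAverage_fun_sum, Finset.sum_filter]
  · refine Finset.sum_congr rfl fun i hi => ?_
    rw [circleAverage_smul, circleAverage_term hτ (ha i (Finset.mem_range.1 hi))]
    split_ifs <;> simp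
  · intro i hi
    refine CircleIntegrable.const_smul ?_
    refine ContinuousOn.circleIntegrable hτ.le fun z hz => ?_
    have : z - a i ≠ 0 := by
      intro h; rw [sub_eq_zero.1 h] at hz
      exact ha i (Finset.mem_range.1 hi) (by simpa using hz)
    have hc : ContinuousAt (fun z => z / (z - a i)) z := by fun_prop (disch := assumption)
    exact hc.continuousWithinAt

theorem annulus_lower {n : ℕ} (ρ a : ℕ → ℂ) {T : Set ℝ} (hT : MeasurableSet T) (hT0 : T ⊆ Set.Ioi 0)
    (ha : ∀ τ ∈ T, ∀ i < n, ‖a i‖ ≠ τ) {c : ℝ}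
    (hc : ∀ τ ∈ T, c ≤ ‖∑ i ∈ Finset.range n with ‖a i‖ < τ, ρ i‖) :
    ENNReal.ofReal (2 * π) * ENNReal.ofReal c * volume T ≤
      ∫⁻ z in {z : ℂ | ‖z‖ ∈ T}, ‖∑ i ∈ Finset.range n, ρ i / (z - a i)‖ₑ := by
  have hm : MeasurableSet {z : ℂ | ‖z‖ ∈ T} := measurableSet_preimage measurable_norm hT
  rw [← lintegral_indicator hm, polar_lintegral]
  swap
  · refine Measurable.indicator ?_ hm
    fun_prop
  calc _ = ∫⁻ τ in T, ENNReal.ofReal (2 * π) * ENNReal.ofReal c := by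
        rw [setLIntegral_const]
    _ ≤ ∫⁻ τ in T, ENNReal.ofReal τ * ∫⁻ θ in Set.Ioo (-π) π, {z : ℂ | ‖z‖ ∈ T}.indicator
          (fun z => ‖∑ i ∈ Finset.range n, ρ i / (z - a i)‖ₑ) (τ * Complex.exp (θ * Complex.I)) := by
        refine setLIntegral_mono' hT fun τ hτ => ?_
        have hτ0 : 0 < τ := hT0 hτ
        have hn : ∀ θ : ℝ, ‖(τ:ℂ) * Complex.exp (θ * Complex.I)‖ = τ := fun θ => by
          rw [norm_mul, Complex.norm_exp_ofReal_mul_I, mul_one, Complex.norm_real, Real.norm_of_nonneg hτ0.le]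
        rw [← lintegral_const_mul' _ _ ENNReal.ofReal_ne_top]
        calc _ ≤ ENNReal.ofReal (2 * π) *
              ‖circleAverage (fun z => z * ∑ i ∈ Finset.range n, ρ i / (z - a i)) 0 τ‖ₑ := by
              gcongr
              rw [circleAverage_q ρ a hτ0 (ha τ hτ), ← ofReal_norm]
              exact ENNReal.ofReal_le_ofReal (hc τ hτ)
          _ ≤ _ := circle_enorm_le _ _ _
          _ = _ := by
              refine lintegral_congr fun θ => ?_
              rw [Set.indicator_of_mem (by show ‖_‖ ∈ T; rw [hn]; exact hτ), zero_add, enorm_mul,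
                ← ofReal_norm (_ * _), hn]
    _ ≤ _ := lintegral_mono_set hT0

theorem annulus_log (a : ℂ) {s B : ℝ} (hs : 0 < s) (hB : s ≤ B) :
    ∫⁻ z in {z : ℂ | s ≤ ‖z - a‖ ∧ ‖z - a‖ ≤ B}, ENNReal.ofReal ((‖z - a‖ ^ 2)⁻¹) =
      ENNReal.ofReal (2 * π * Real.log (B / s)) := by
  have hm : MeasurableSet {z : ℂ | s ≤ ‖z - a‖ ∧ ‖z - a‖ ≤ B} :=
    measurableSet_preimage (by fun_prop : Measurable fun z : ℂ => ‖z - a‖) (measurableSet_Icc (a := s) (b := B))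
  rw [← lintegral_indicator hm]
  have e : (fun z : ℂ => {z : ℂ | s ≤ ‖z - a‖ ∧ ‖z - a‖ ≤ B}.indicator
      (fun z => ENNReal.ofReal ((‖z - a‖ ^ 2)⁻¹)) z) =
      fun z => (fun w : ℂ => (Set.Icc s B).indicator (fun r => ENNReal.ofReal ((r ^ 2)⁻¹)) ‖w‖) (z - a) := by
    ext z
    simp only [Set.indicator]
    rfl
  rw [e, lintegral_sub_right_eq_self (fun w : ℂ => (Set.Icc s B).indicator (fun r => ENNReal.ofReal ((r ^ 2)⁻¹)) ‖w‖),
    polar_radial (Measurable.indicator (by fun_prop) measurableSet_Icc)]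
  rw [ENNReal.ofReal_mul (by positivity : (0:ℝ) ≤ 2 * π)]
  congr 1
  have e2 : ∀ r : ℝ, ENNReal.ofReal r * (Set.Icc s B).indicator (fun r => ENNReal.ofReal ((r ^ 2)⁻¹)) r =
      (Set.Icc s B).indicator (fun r => ENNReal.ofReal (r⁻¹)) r := by
    intro r
    by_cases hr : r ∈ Set.Icc s B
    · have hr0 : 0 < r := hs.trans_le hr.1
      rw [Set.indicator_of_mem hr, Set.indicator_of_mem hr, ← ENNReal.ofReal_mul hr0.le]
      congr 1; field_simp
    · rw [Set.indicator_of_notMem hr, Set.indicator_of_notMem hr, mul_zero]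
  simp_rw [e2]
  rw [setLIntegral_indicator measurableSet_Icc, Set.inter_eq_left.2 (fun x (hx : x ∈ Set.Icc s B) => Set.mem_Ioi.2 (hs.trans_le hx.1))]
  rw [← integral_inv_of_pos hs (hs.trans_le hB), intervalIntegral.integral_of_le hB,
    ← integral_Icc_eq_integral_Ioc, ofReal_integral_eq_lintegral_ofReal]
  · refine ContinuousOn.integrableOn_compact isCompact_Icc fun x hx => ?_
    exact (continuousAt_inv₀ (hs.trans_le hx.1).ne').continuousWithinAt
  · filter_upwards [ae_restrict_mem measurableSet_Icc] with x hx
    exact inv_nonneg.2 (hs.trans_le hx.1).le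

theorem pow_lip {d : ℕ} {R : ℝ} (hR : R ^ (d - 1) = 2) {w x : ℂ} (hw : ‖w‖ ≤ R) (hx : ‖x‖ ≤ R) :
    ‖w ^ d - x ^ d‖ ≤ 2 * d * ‖w - x‖ := by
  have hR0 : 0 ≤ R := (norm_nonneg _).trans hw
  rw [← (Commute.all w x).geom_sum₂_mul d, norm_mul]
  gcongr
  calc _ ≤ ∑ i ∈ Finset.range d, ‖w ^ i * x ^ (d - 1 - i)‖ := norm_sum_le _ _
    _ ≤ ∑ i ∈ Finset.range d, (2:ℝ) := by
        refine Finset.sum_le_sum fun i hi => ?_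
        have := Finset.mem_range.1 hi
        rw [norm_mul, norm_pow, norm_pow]
        calc _ ≤ R ^ i * R ^ (d - 1 - i) := by gcongr
          _ = 2 := by rw [← pow_add, ← hR]; congr 1; omega
    _ = 2 * d := by simp [mul_comm]

theorem T_volume {n : ℕ} (b c : ℕ → ℝ) {r : ℝ} (hr : 0 < r) (hc : ∀ i, 0 ≤ c i)
    (hsum : ∑ i ∈ Finset.range n, 2 * c i ≤ r / 2) :
    ENNReal.ofReal (r / 2) ≤ volume (Set.Ioo r (2 * r) ∩ {τ | ∀ i < n, c i < |τ - b i|}) := by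
  set T := Set.Ioo r (2 * r) ∩ {τ | ∀ i < n, c i < |τ - b i|} with hT
  have h1 : Set.Ioo r (2 * r) ⊆ T ∪ ⋃ i ∈ Finset.range n, Set.Icc (b i - c i) (b i + c i) := by
    intro τ hτ
    by_cases h : ∀ i < n, c i < |τ - b i|
    · exact Or.inl ⟨hτ, h⟩
    · push Not at h
      obtain ⟨i, hi, h⟩ := h
      refine Or.inr ?_
      simp only [Set.mem_iUnion]
      refine ⟨i, Finset.mem_range.2 hi, ?_⟩
      have := abs_le.1 h
      constructor <;> linarith [this.1, this.2]
  have h2 := (measure_mono (μ := volume) h1).trans (measure_union_le _ _)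
  have h3 : volume (⋃ i ∈ Finset.range n, Set.Icc (b i - c i) (b i + c i)) ≤ ENNReal.ofReal (r / 2) := by
    refine (measure_biUnion_finset_le _ _).trans ?_
    simp only [Real.volume_Icc]
    rw [← ENNReal.ofReal_sum_of_nonneg (fun i _ => by linarith [hc i])]
    refine ENNReal.ofReal_le_ofReal (le_trans (le_of_eq ?_) hsum)
    exact Finset.sum_congr rfl fun i _ => by ring
  have h4 : ENNReal.ofReal (r / 2) + ENNReal.ofReal (r / 2) ≤ volume T + ENNReal.ofReal (r / 2) := by
    rw [← ENNReal.ofReal_add (by positivity) (by positivity)]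
    calc _ = volume (Set.Ioo r (2 * r)) := by rw [Real.volume_Ioo]; congr 1; ring
      _ ≤ _ := h2
      _ ≤ _ := by gcongr
  exact (ENNReal.add_le_add_iff_right ENNReal.ofReal_ne_top).1 h4

set_option maxHeartbeats 1000000 in
theorem transv {d : ℕ} (hd : 1 < d) {R : ℝ} (hR1 : 1 < R) (hR : R ^ (d - 1) = 2) {lam : ℂ}
    {F ρ : ℕ → ℂ} (hF1 : F 1 = lam) (hF : ∀ i, F (i + 1) = F i ^ d + lam) {n : ℕ}
    (hρn : ρ (n + 1) = 1) (hρ : ∀ i, 1 ≤ i → i ≤ n → ρ i = d * F i ^ (d - 1) * ρ (i + 1))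
    (hsum : ∑ i ∈ Finset.range (n + 1), ρ (i + 1) = 0)
    (hbd : ∀ i ≤ n, ‖F (i + 1)‖ ≤ R) {r : ℝ} (hr : 0 < r) (hFm : ‖F (n + 1)‖ ≤ r / 2)
    (h2 : (n + 1) * (d * (2 * r) ^ (d - 1) * (2 * d) ^ (n + 1)) ≤ (1 / 4 : ℝ)) :
    9 / 32 * d * r ≤ ‖F (n + 1)‖ * Real.log (2 * R / (2 * r) ^ d) := by
  classical
  have hR0 : 0 < R := by linarith
  have hd2 : (2:ℝ) ≤ d := by exact_mod_cast hd
  set K : ℝ := 2 * d with hK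
  have hK4 : 4 ≤ K := by linarith
  have hK1 : 1 ≤ K := by linarith
  set s : ℝ := (2 * r) ^ d with hs
  have hs0 : 0 < s := by positivity
  have hss : s = (2 * r) ^ (d - 1) * (2 * r) := by
    rw [hs, ← pow_succ]; congr 1; omega
  set t : ℝ := (2 * r) ^ (d - 1) with ht
  have ht0 : 0 < t := by positivity
  have h3 : (n + 1) * (t * K ^ n) ≤ 1 / 32 := by
    have e : (n + 1) * (d * t * K ^ (n + 1)) = ((n + 1) * (t * K ^ n)) * (d * K) := by rw [pow_succ]; ring
    rw [e] at h2
    have hdK : 8 ≤ (d:ℝ) * K := by nlinarith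
    have hpos : 0 ≤ (n + 1) * (t * K ^ n) := by positivity
    nlinarith
  have hKn1 : 1 ≤ K ^ n := one_le_pow₀ hK1
  have h4 : t * K ^ n ≤ 1 / 32 := by
    have hpos : 0 ≤ t * K ^ n := by positivity
    have : (0:ℝ) ≤ n := by positivity
    nlinarith
  have h5 : t ≤ 1 / 32 := by nlinarith
  have h2r : 2 * r < 1 := by
    by_contra h
    push Not at h
    have : 1 ≤ t := one_le_pow₀ h
    linarith
  have hKns : K ^ n * s ≤ r / 2 := by rw [hss]; nlinarith
  have hsr : s ≤ r / 16 := by rw [hss]; nlinarith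
  have hKi : ∀ i ≤ n, K ^ i * s ≤ K ^ n * s := fun i hi => by gcongr
  have hρb : ∀ j ≤ n, ‖ρ (n + 1 - j)‖ ≤ K ^ j := by
    intro j
    induction j with
    | zero => intro _; simp [hρn]
    | succ j ih =>
      intro hj
      have := ih (by omega)
      rw [hρ (n + 1 - (j + 1)) (by omega) (by omega), show n + 1 - (j + 1) + 1 = n + 1 - j by omega,
        norm_mul, pow_succ', norm_mul, norm_pow, Complex.norm_natCast]
      have hb := hbd (n + 1 - (j + 1) - 1) (by omega)
      rw [show n + 1 - (j + 1) - 1 + 1 = n + 1 - (j + 1) by omega] at hb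
      gcongr
      calc (d:ℝ) * ‖F (n + 1 - (j + 1))‖ ^ (d - 1) ≤ d * R ^ (d - 1) := by gcongr
        _ = K := by rw [hR, hK]; ring
  have hρb' : ∀ i ≤ n, ‖ρ (i + 1)‖ ≤ K ^ n := by
    intro i hi
    have := hρb (n - i) (by omega)
    rw [show n + 1 - (n - i) = i + 1 by omega] at this
    exact this.trans (pow_le_pow_right₀ hK1 (by omega))
  set q : ℂ → ℂ := fun z => ∑ i ∈ Finset.range (n + 1), ρ (i + 1) / (z - F (i + 1)) with hq
  set E : ℂ → ℂ := fun z => (F (n + 1) / d) / ((z - F 1) * (z - F (n + 2))) with hE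
  have hqm : Measurable q := by fun_prop
  have hEm : Measurable E := by fun_prop
  set V : Set ℂ := {z | ‖z‖ < R ∧ r < ‖z‖ ∧ ∀ i < n + 1, K ^ i * s < ‖z - F (i + 1)‖} with hV
  have hVm : MeasurableSet V := by
    refine MeasurableSet.inter (measurableSet_lt (f := fun z : ℂ => ‖z‖) (g := fun _ => R)
      (by fun_prop) (by fun_prop)) ?_
    refine MeasurableSet.inter (measurableSet_lt (f := fun _ => r) (g := fun z : ℂ => ‖z‖)
      (by fun_prop) (by fun_prop)) ?_
    have : {z : ℂ | ∀ i < n + 1, K ^ i * s < ‖z - F (i + 1)‖} =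
        ⋂ i, ⋂ (_ : i < n + 1), {z : ℂ | K ^ i * s < ‖z - F (i + 1)‖} := by
      ext z; simp
    change MeasurableSet {z : ℂ | ∀ i < n + 1, K ^ i * s < ‖z - F (i + 1)‖}
    rw [this]
    exact MeasurableSet.iInter fun i => MeasurableSet.iInter fun _ =>
      measurableSet_lt (by fun_prop) (by fun_prop)
  set T : Set ℝ := Set.Ioo r (2 * r) ∩ {τ | ∀ i < n + 1, K ^ i * s < |τ - ‖F (i + 1)‖|} with hT
  have hTm : MeasurableSet T := by
    refine measurableSet_Ioo.inter ?_
    have : {τ : ℝ | ∀ i < n + 1, K ^ i * s < |τ - ‖F (i + 1)‖|} =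
        ⋂ i, ⋂ (_ : i < n + 1), {τ : ℝ | K ^ i * s < |τ - ‖F (i + 1)‖|} := by
      ext z; simp
    rw [this]
    exact MeasurableSet.iInter fun i => MeasurableSet.iInter fun _ =>
      measurableSet_lt (by fun_prop) (by fun_prop)
  have hTvol : ENNReal.ofReal (r / 2) ≤ volume T := by
    refine T_volume (fun i => ‖F (i + 1)‖) (fun i => K ^ i * s) hr (fun i => by positivity) ?_
    calc ∑ i ∈ Finset.range (n + 1), 2 * (K ^ i * s) ≤ ∑ i ∈ Finset.range (n + 1), 2 * (K ^ n * s) := by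
          refine Finset.sum_le_sum fun i hi => ?_
          have := hKi i (by have := Finset.mem_range.1 hi; omega)
          linarith
      _ = ((n + 1) * (t * K ^ n)) * (4 * r) := by rw [hss]; simp; ring
      _ ≤ r / 2 := by nlinarith
  set A : Set ℂ := {z | ‖z‖ ∈ T} with hA
  have hAm : MeasurableSet A := measurableSet_preimage measurable_norm hTm
  have hlamR : ‖lam‖ ≤ R := by have := hbd 0 (by omega); rwa [zero_add, hF1] at this
  have hAV : A ⊆ V := by
    rintro z ⟨⟨hz1, hz2⟩, hz3⟩
    refine ⟨by linarith, hz1, fun i hi => (hz3 i hi).trans_le ?_⟩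
    exact abs_norm_sub_norm_le _ _
  have hpre : {w | w ^ d + lam ∈ V} ⊆ V \ A := by
    rintro w ⟨hz1, hz2, hz3⟩
    have hwR : ‖w‖ < R := by
      by_contra h
      push Not at h
      have e1 : ‖w ^ d‖ ≤ ‖w ^ d + lam‖ + ‖lam‖ := by
        calc ‖w ^ d‖ = ‖w ^ d + lam - lam‖ := by rw [add_sub_cancel_right]
          _ ≤ _ := norm_sub_le _ _
      have e2 : R ^ d ≤ ‖w ^ d‖ := by rw [norm_pow]; gcongr
      have e3 : R ^ d = 2 * R := by rw [← hR, ← pow_succ]; congr 1; omega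
      linarith
    have hw2 : 2 * r < ‖w‖ := by
      by_contra h
      push Not at h
      have := hz3 0 (by omega)
      rw [zero_add, hF1, add_sub_cancel_right, norm_pow, pow_zero, one_mul] at this
      have : ‖w‖ ^ d ≤ s := by rw [hs]; gcongr
      linarith
    refine ⟨⟨hwR, by linarith, fun i hi => ?_⟩, fun h => ?_⟩
    · by_contra h
      push Not at h
      rcases Nat.lt_or_ge i n with hin | hin
      · have := hz3 (i + 1) (by omega)
        rw [hF (i + 1), add_sub_add_right_eq_sub] at this
        have h6 := pow_lip (d := d) hR hwR.le (hbd i (by omega))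
        have : K * ‖w - F (i + 1)‖ ≤ K * (K ^ i * s) := by gcongr
        rw [pow_succ'] at *
        nlinarith
      · have : i = n := by omega
        subst this
        have e1 : ‖w‖ ≤ ‖w - F (i + 1)‖ + ‖F (i + 1)‖ := by
          calc ‖w‖ = ‖w - F (i + 1) + F (i + 1)‖ := by rw [sub_add_cancel]
            _ ≤ _ := norm_add_le _ _
        linarith
    · have : ‖w‖ < 2 * r := h.1.2
      linarith
  obtain ⟨ζ, hζ⟩ : ∃ ζ : ℂ, IsPrimitiveRoot ζ d :=
    ⟨_, Complex.isPrimitiveRoot_exp d (by omega)⟩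
  have hζ1 : ∀ k, ‖ζ ^ k‖ = 1 := fun k => by
    rw [norm_pow, hζ.norm'_eq_one (by omega), one_pow]
  have hdist : ∀ z ∈ V, s < ‖z - F 1‖ ∧ 3 / 4 * ‖z - F 1‖ ≤ ‖z - F (n + 2)‖ := by
    intro z hz
    have h6 := hz.2.2 0 (by omega)
    rw [pow_zero, one_mul, zero_add] at h6
    refine ⟨h6, ?_⟩
    have h7 : ‖F (n + 2) - F 1‖ ≤ s / 4 := by
      rw [hF (n + 1), hF1, add_sub_cancel_right, norm_pow]
      calc ‖F (n + 1)‖ ^ d ≤ (2 * r / 4) ^ d := by gcongr; linarith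
        _ = s / 4 ^ d := by rw [div_pow]
        _ ≤ s / 4 := by
            gcongr
            calc (4:ℝ) = 4 ^ 1 := by norm_num
              _ ≤ 4 ^ d := pow_le_pow_right₀ (by norm_num) (by omega)
    have h8 : ‖z - F 1‖ ≤ ‖z - F (n + 2)‖ + ‖F (n + 2) - F 1‖ := by
      calc ‖z - F 1‖ = ‖(z - F (n + 2)) + (F (n + 2) - F 1)‖ := by congr 1; ring
        _ ≤ _ := norm_add_le _ _
    linarith
  have hpush : ∫⁻ z in V, ‖q z + E z‖ₑ ≤ ∫⁻ w in {w | w ^ d + lam ∈ V}, ‖q w‖ₑ := by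
    refine push_ineq hd hζ lam hVm (by fun_prop) fun w hw hz => ?_
    have hne : ∀ i ≤ n + 1, w ^ d + lam - F (i + 1) ≠ 0 := by
      intro i hi
      rw [← norm_pos_iff]
      rcases Nat.lt_or_ge i (n + 1) with h | h
      · exact lt_of_le_of_lt (by positivity) (hz.2.2 i h)
      · have : i = n + 1 := by omega
        subst this
        have := hdist _ hz
        linarith [this.1, this.2]
    have hid := qd_identity hd hζ hF1 hF hρn hρ hsum hw hne
    calc _ = ‖((d:ℂ) * w ^ (d - 1)) ^ 2 * (q (w ^ d + lam) + E (w ^ d + lam))‖ₑ := by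
          rw [enorm_mul (_ ^ 2), enorm_pow _ 2]
      _ = ‖∑ k ∈ Finset.range d, (ζ ^ k) ^ 2 * q (ζ ^ k * w)‖ₑ := by rw [hid]
      _ ≤ ∑ k ∈ Finset.range d, ‖(ζ ^ k) ^ 2 * q (ζ ^ k * w)‖ₑ := enorm_sum_le _ _
      _ = _ := by
          refine Finset.sum_congr rfl fun k _ => ?_
          rw [enorm_mul, enorm_pow, ← ofReal_norm (ζ ^ k), hζ1]; simp
  have hqb : ∀ z ∈ V, ‖q z‖ ≤ (n + 1) * (K ^ n / s) := by
    intro z hz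
    calc ‖q z‖ ≤ ∑ i ∈ Finset.range (n + 1), ‖ρ (i + 1) / (z - F (i + 1))‖ := norm_sum_le _ _
      _ ≤ ∑ i ∈ Finset.range (n + 1), K ^ n / s := by
          refine Finset.sum_le_sum fun i hi => ?_
          have hi' := Finset.mem_range.1 hi
          have h6 := hz.2.2 i hi'
          have h7 : s ≤ K ^ i * s := le_mul_of_one_le_left hs0.le (one_le_pow₀ hK1)
          rw [norm_div]
          gcongr
          · exact hρb' i (by omega)
          · linarith
      _ = _ := by simp
  have hfin : ∫⁻ z in V \ A, ‖q z‖ₑ ≠ ⊤ := by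
    refine ne_of_lt ?_
    calc ∫⁻ z in V \ A, ‖q z‖ₑ ≤ ∫⁻ z in V, ‖q z‖ₑ := lintegral_mono_set Set.sdiff_subset
      _ ≤ ∫⁻ z in V, ENNReal.ofReal ((n + 1) * (K ^ n / s)) := by
          refine setLIntegral_mono' hVm fun z hz => ?_
          rw [← ofReal_norm]
          exact ENNReal.ofReal_le_ofReal (hqb z hz)
      _ = ENNReal.ofReal ((n + 1) * (K ^ n / s)) * volume V := setLIntegral_const _ _
      _ < ⊤ := by
          refine ENNReal.mul_lt_top ENNReal.ofReal_lt_top ?_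
          refine lt_of_le_of_lt (measure_mono (t := Metric.ball 0 R) ?_) measure_ball_lt_top
          intro z hz; simpa using hz.1
  have hmain : ∫⁻ z in A, ‖q z‖ₑ ≤ ∫⁻ z in V, ‖E z‖ₑ := by
    have e1 : ∫⁻ z in V, ‖q z‖ₑ ≤ (∫⁻ z in V, ‖q z + E z‖ₑ) + ∫⁻ z in V, ‖E z‖ₑ := by
      rw [← lintegral_add_left (by fun_prop)]
      refine lintegral_mono fun z => ?_
      calc ‖q z‖ₑ = ‖(q z + E z) - E z‖ₑ := by rw [add_sub_cancel_right]
        _ ≤ _ := enorm_sub_le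
    have e2 : (∫⁻ z in A, ‖q z‖ₑ) + ∫⁻ z in V \ A, ‖q z‖ₑ = ∫⁻ z in V, ‖q z‖ₑ := by
      have := lintegral_inter_add_sdiff (μ := volume) (fun z => ‖q z‖ₑ) V hAm
      rwa [Set.inter_eq_right.2 hAV] at this
    have e3 := hpush.trans (lintegral_mono_set hpre)
    have e4 : (∫⁻ z in A, ‖q z‖ₑ) + ∫⁻ z in V \ A, ‖q z‖ₑ ≤ (∫⁻ z in V, ‖E z‖ₑ) + ∫⁻ z in V \ A, ‖q z‖ₑ := by
      rw [e2, add_comm (∫⁻ z in V, ‖E z‖ₑ)]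
      exact e1.trans (by gcongr)
    exact (ENNReal.add_le_add_iff_right hfin).1 e4
  have hs2R : s ≤ 2 * R := by linarith
  have hlog : 0 ≤ Real.log (2 * R / s) := Real.log_nonneg (by rw [le_div_iff₀ hs0]; linarith)
  have hup : ∫⁻ z in V, ‖E z‖ₑ ≤ ENNReal.ofReal (‖F (n + 1)‖ / d * (4 / 3) * (2 * π * Real.log (2 * R / s))) := by
    rw [ENNReal.ofReal_mul (by positivity), ← annulus_log (F 1) hs0 hs2R,
      ← lintegral_const_mul' _ _ ENNReal.ofReal_ne_top]
    calc _ ≤ ∫⁻ z in V, ENNReal.ofReal (‖F (n + 1)‖ / d * (4 / 3)) * ENNReal.ofReal ((‖z - F 1‖ ^ 2)⁻¹) := by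
          refine setLIntegral_mono' hVm fun z hz => ?_
          obtain ⟨h6, h7⟩ := hdist z hz
          rw [← ENNReal.ofReal_mul (by positivity), ← ofReal_norm]
          refine ENNReal.ofReal_le_ofReal ?_
          have h8 : 0 < ‖z - F 1‖ := hs0.trans h6
          simp only [hE, norm_div, norm_mul, Complex.norm_natCast]
          calc ‖F (n + 1)‖ / d / (‖z - F 1‖ * ‖z - F (n + 2)‖)
              ≤ ‖F (n + 1)‖ / d / (‖z - F 1‖ * (3 / 4 * ‖z - F 1‖)) := by gcongr
            _ = _ := by field_simp
      _ ≤ _ := by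
          refine lintegral_mono_set fun z hz => ?_
          refine ⟨(hdist z hz).1.le, ?_⟩
          have := norm_sub_le z (F 1)
          rw [hF1] at *
          linarith [hz.1]
  have hlow := annulus_lower (n := n + 1) (fun i => ρ (i + 1)) (fun i => F (i + 1)) (c := 3 / 4) hTm
    (fun τ hτ => hr.trans hτ.1.1)
    (fun τ hτ i hi he => by
      have := hτ.2 i hi
      simp only [he, sub_self, abs_zero] at this
      have : 0 < K ^ i * s := by positivity
      linarith)
    (by
      intro τ hτ
      have hsplit : Finset.range (n + 1) = insert n (Finset.range n) := Finset.range_add_one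
      have hn : ‖F (n + 1)‖ < τ := by linarith [hτ.1.1]
      rw [hsplit, Finset.filter_insert, if_pos hn, Finset.sum_insert (by simp), hρn]
      have hb : ‖∑ i ∈ Finset.range n with ‖F (i + 1)‖ < τ, ρ (i + 1)‖ ≤ 1 / 4 := by
        calc _ ≤ ∑ i ∈ Finset.range n with ‖F (i + 1)‖ < τ, ‖ρ (i + 1)‖ := norm_sum_le _ _
          _ ≤ ∑ i ∈ Finset.range n with ‖F (i + 1)‖ < τ, d * t * K ^ (n + 1) := by
              refine Finset.sum_le_sum fun i hi => ?_
              obtain ⟨hi1, hi2⟩ := Finset.mem_filter.1 hi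
              have hi1 := Finset.mem_range.1 hi1
              rw [hρ (i + 1) (by omega) (by omega), norm_mul, norm_mul, norm_pow, Complex.norm_natCast]
              gcongr
              · rw [ht]
                gcongr
                linarith [hτ.1.2]
              · exact (hρb' (i + 1) (by omega)).trans (pow_le_pow_right₀ hK1 (by omega))
          _ ≤ ∑ i ∈ Finset.range n, d * t * K ^ (n + 1) :=
              Finset.sum_le_sum_of_subset_of_nonneg (Finset.filter_subset _ _) fun _ _ _ => by positivity
          _ = n * (d * t * K ^ (n + 1)) := by simp
          _ ≤ _ := by
              have : 0 ≤ d * t * K ^ (n + 1) := by positivity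
              linarith
      have := norm_sub_norm_le (1:ℂ) (-∑ i ∈ Finset.range n with ‖F (i + 1)‖ < τ, ρ (i + 1))
      rw [norm_neg, sub_neg_eq_add, norm_one] at this
      linarith)
  have hfinal : ENNReal.ofReal (2 * π * (3 / 4) * (r / 2)) ≤
      ENNReal.ofReal (‖F (n + 1)‖ / d * (4 / 3) * (2 * π * Real.log (2 * R / s))) := by
    rw [ENNReal.ofReal_mul (by positivity), ENNReal.ofReal_mul (by positivity)]
    calc _ ≤ ENNReal.ofReal (2 * π) * ENNReal.ofReal (3 / 4) * volume T := by gcongr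
      _ ≤ _ := hlow.trans (hmain.trans hup)
  have h9 := (ENNReal.ofReal_le_ofReal_iff (by positivity)).1 hfinal
  have h10 : 2 * π * (3 / 8 * r) ≤ 2 * π * (‖F (n + 1)‖ / d * (4 / 3) * Real.log (2 * R / s)) := by
    linarith
  have h11 := le_of_mul_le_mul_left h10 (by positivity)
  have hd0 : (0:ℝ) < d := by linarith
  calc 9 / 32 * d * r = 3 / 4 * d * (3 / 8 * r) := by ring
    _ ≤ 3 / 4 * d * (‖F (n + 1)‖ / d * (4 / 3) * Real.log (2 * R / s)) := by gcongr
    _ = ‖F (n + 1)‖ * Real.log (2 * R / s) * (d / d) := by ring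
    _ = _ := by rw [div_self hd0.ne', mul_one]

noncomputable def critPoly (d : ℕ) : ℕ → Polynomial ℂ
  | 0 => 0
  | n + 1 => critPoly d n ^ d + Polynomial.X

theorem fc_succ (d : ℕ) (lam : ℂ) (i : ℕ) :
    (fc d lam)^[i + 1] 0 = ((fc d lam)^[i] 0) ^ d + lam := by
  rw [Function.iterate_succ_apply']; rfl

theorem critPoly_eval (d n : ℕ) (lam : ℂ) : (critPoly d n).eval lam = (fc d lam)^[n] 0 := by
  induction n with
  | zero => simp [critPoly]
  | succ n ih => rw [fc_succ, ← ih]; simp [critPoly]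

theorem critPoly_deriv (d n : ℕ) (lam : ℂ) : (critPoly d n).derivative.eval lam =
    ∑ i ∈ Finset.range n, ∏ l ∈ Finset.Ico (i + 1) n, (d * ((fc d lam)^[l] 0) ^ (d - 1)) := by
  induction n with
  | zero => simp [critPoly]
  | succ n ih =>
    rw [Finset.sum_range_succ, Finset.Ico_self, Finset.prod_empty]
    have : ∀ i ∈ Finset.range n, ∏ l ∈ Finset.Ico (i + 1) (n + 1), (d * ((fc d lam)^[l] 0) ^ (d - 1)) =
        (∏ l ∈ Finset.Ico (i + 1) n, (d * ((fc d lam)^[l] 0) ^ (d - 1))) * (d * ((fc d lam)^[n] 0) ^ (d - 1)) := by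
      intro i hi
      rw [Finset.prod_Ico_succ_top]
      have := Finset.mem_range.1 hi
      omega
    rw [Finset.sum_congr rfl this, ← Finset.sum_mul, ← ih]
    simp [critPoly, Polynomial.derivative_pow, critPoly_eval]
    ring

theorem escape {d : ℕ} (hd : 1 < d) {R : ℝ} (hR1 : 1 < R) (hR : R ^ (d - 1) = 2) {lam : ℂ} {i : ℕ}
    (h1 : R ≤ ‖(fc d lam)^[i] 0‖) (h2 : ‖lam‖ ≤ ‖(fc d lam)^[i] 0‖) (k : ℕ) :
    ‖(fc d lam)^[i] 0‖ ≤ ‖(fc d lam)^[i + k] 0‖ := by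
  induction k with
  | zero => simp
  | succ k ih =>
    refine ih.trans ?_
    rw [← add_assoc, fc_succ]
    set x := (fc d lam)^[i + k] 0
    have e1 : ‖x ^ d‖ ≤ ‖x ^ d + lam‖ + ‖lam‖ := by
      calc ‖x ^ d‖ = ‖x ^ d + lam - lam‖ := by rw [add_sub_cancel_right]
        _ ≤ _ := norm_sub_le _ _
    have e2 : ‖x ^ d‖ = ‖x‖ ^ (d - 1) * ‖x‖ := by
      rw [norm_pow, ← pow_succ]; congr 1; omega
    have e3 : 2 ≤ ‖x‖ ^ (d - 1) := by
      rw [← hR]; gcongr; linarith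
    nlinarith [norm_nonneg x]

theorem orbit_bound {d : ℕ} (hd : 1 < d) {R : ℝ} (hR1 : 1 < R) (hR : R ^ (d - 1) = 2) {lam : ℂ} {n : ℕ}
    (hn : ‖(fc d lam)^[n + 1] 0‖ ≤ R) : ‖lam‖ ≤ R ∧ ∀ i ≤ n, ‖(fc d lam)^[i + 1] 0‖ ≤ R := by
  have hF1 : (fc d lam)^[1] 0 = lam := by simp [fc, show d ≠ 0 by omega]
  have h0 : ‖lam‖ ≤ R := by
    by_contra h
    push Not at h
    have := escape hd hR1 hR (lam := lam) (i := 1) (by rw [hF1]; exact h.le) (by rw [hF1]) n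
    rw [hF1, add_comm] at this
    linarith
  refine ⟨h0, fun i hi => ?_⟩
  by_contra h
  push Not at h
  have := escape hd hR1 hR (lam := lam) (i := i + 1) h.le (by linarith) (n - i)
  rw [show i + 1 + (n - i) = n + 1 by omega] at this
  linarith

theorem exists_R {d : ℕ} (hd : 1 < d) : ∃ R : ℝ, 1 < R ∧ R ≤ 2 ∧ R ^ (d - 1) = 2 := by
  have hd1 : d - 1 ≠ 0 := by omega
  refine ⟨(2:ℝ) ^ (((d - 1 : ℕ) : ℝ)⁻¹), ?_, ?_, Real.rpow_inv_natCast_pow (by norm_num) hd1⟩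
  · exact Real.one_lt_rpow (by norm_num) (by positivity)
  · calc (2:ℝ) ^ (((d - 1 : ℕ) : ℝ)⁻¹) ≤ (2:ℝ) ^ (1:ℝ) := by
          refine Real.rpow_le_rpow_of_exponent_le (by norm_num) ?_
          refine inv_le_one_of_one_le₀ ?_
          exact_mod_cast (by omega : 1 ≤ d - 1)
      _ = 2 := by norm_num

theorem exists_delta {d : ℕ} (hd : 1 < d) : ∃ C : ℝ, 0 ≤ C ∧ ∀ n : ℕ, ∃ δ : ℝ, 0 < δ ∧ δ ≤ 1 ∧
    -Real.log δ ≤ (n + 1) * Real.log (2 * d) / (d - 1) + C + 2 * Real.log (n + 1) ∧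
    ∀ lam : ℂ, ‖(critPoly d (n + 1)).eval lam‖ < δ → (critPoly d (n + 1)).derivative.eval lam ≠ 0 := by
  obtain ⟨R, hR1, hR2, hR⟩ := exists_R hd
  have hd2 : (2:ℝ) ≤ d := by exact_mod_cast hd
  set c1 : ℝ := Real.log (4 * d) + 1 + Real.log (2 * d) with hc1
  have hl4 : 0 ≤ Real.log (4 * d) := Real.log_nonneg (by linarith)
  have hl2 : 0 ≤ Real.log (2 * d) := Real.log_nonneg (by linarith)
  set c2 : ℝ := 2 + 2 * c1 with hc2
  have hc2' : 4 ≤ c2 := by linarith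
  refine ⟨Real.log (4 * d) + Real.log (4 * c2), add_nonneg hl4 (Real.log_nonneg (by linarith)), fun n => ?_⟩
  set m : ℝ := (n:ℝ) + 1 with hm
  have hm1 : 1 ≤ m := by rw [hm]; linarith [(Nat.cast_nonneg n : (0:ℝ) ≤ n)]
  have hlm0 : 0 ≤ Real.log m := Real.log_nonneg hm1
  have hlm : Real.log m ≤ m := (Real.log_le_sub_one_of_pos (by linarith)).trans (by linarith)
  set X : ℝ := 4 * d * m * (2 * d) ^ (n + 1) with hX
  have hX0 : 0 < X := by positivity
  have hlX : Real.log X = Real.log (4 * d) + Real.log m + m * Real.log (2 * d) := by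
    rw [hX, Real.log_mul (by positivity) (by positivity), Real.log_mul (by positivity) (by positivity),
      Real.log_pow]
    push_cast; rfl
  have hX1 : 1 ≤ X := by
    have : 1 ≤ (2 * (d:ℝ)) ^ (n + 1) := one_le_pow₀ (by linarith)
    calc (1:ℝ) = 1 * 1 * 1 := by norm_num
      _ ≤ (4 * d) * m * (2 * d) ^ (n + 1) := by gcongr; linarith
  have hlX0 : 0 ≤ Real.log X := Real.log_nonneg hX1
  have hd1 : d - 1 ≠ 0 := by omega
  have hcast : ((d - 1 : ℕ) : ℝ) = d - 1 := by rw [Nat.cast_sub (by omega)]; simp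
  set y : ℝ := (X⁻¹) ^ (((d - 1 : ℕ) : ℝ)⁻¹) with hy
  have hy0 : 0 < y := by positivity
  have hyd : y ^ (d - 1) = X⁻¹ := Real.rpow_inv_natCast_pow (by positivity) hd1
  have hly : Real.log y = -(Real.log X / (d - 1)) := by
    rw [hy, Real.log_rpow (by positivity), Real.log_inv, hcast]; ring
  have hy1 : y ≤ 1 := Real.rpow_le_one (by positivity) (inv_le_one_of_one_le₀ hX1) (by positivity)
  have hlog : Real.log (2 * R / y ^ d) ≤ c2 * m := by
    rw [Real.log_div (by positivity) (by positivity), Real.log_pow, hly]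
    have e1 : Real.log (2 * R) ≤ 2 := by
      have h4 : Real.log (2 * R) ≤ Real.log (2 * 2) := Real.log_le_log (by linarith) (by linarith)
      have : Real.log (2 * 2) = 2 * Real.log 2 := by rw [Real.log_mul] <;> norm_num; ring
      linarith [Real.log_two_lt_d9]
    have e2 : (d:ℝ) * (Real.log X / (d - 1)) ≤ 2 * Real.log X := by
      rw [mul_div_assoc', div_le_iff₀ (by linarith)]
      nlinarith
    have e3 : Real.log X ≤ c1 * m := by
      rw [hlX, hc1]
      nlinarith
    rw [hc2]
    nlinarith
  have hp : (0:ℝ) < 4 * (c2 * m) := by positivity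
  have hc2m : 4 ≤ c2 * m := by nlinarith
  refine ⟨y / (4 * (c2 * m)), by positivity, ?_, ?_, ?_⟩
  · rw [div_le_one hp]; linarith
  · rw [Real.log_div hy0.ne' hp.ne', hly, hlX, ← mul_assoc, Real.log_mul (x := 4 * c2) (by positivity) (by positivity)]
    have : (Real.log (4 * d) + Real.log m + m * Real.log (2 * d)) / (d - 1) ≤
        m * Real.log (2 * d) / (d - 1) + Real.log (4 * d) + Real.log m := by
      have g1 : Real.log (4 * d) / (d - 1) ≤ Real.log (4 * d) := div_le_self hl4 (by linarith)
      have g2 : Real.log m / (d - 1) ≤ Real.log m := div_le_self hlm0 (by linarith)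
      rw [add_div, add_div]
      linarith
    linarith
  · intro lam hlt h0
    rw [critPoly_eval] at hlt
    have hF1 : (fc d lam)^[1] 0 = lam := by simp [fc, show d ≠ 0 by omega]
    have hq : y / (4 * (c2 * m)) ≤ y / 4 := by gcongr; linarith
    have hob := orbit_bound hd hR1 hR (lam := lam) (n := n) (by linarith)
    have key := transv hd hR1 hR (F := fun i => (fc d lam)^[i] 0)
      (ρ := fun i => ∏ l ∈ Finset.Ico i (n + 1), (d * ((fc d lam)^[l] 0) ^ (d - 1)))
      hF1 (fc_succ d lam) (n := n) (by simp)
      (fun i h1 h2 => by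
        rw [Finset.prod_eq_prod_Ico_succ_bot (by omega)])
      ((critPoly_deriv d (n + 1) lam).symm.trans h0) hob.2 (r := y / 2) (by positivity) (by linarith)
      (by
        rw [show 2 * (y / 2) = y by ring, hyd, ← hm, hX]
        refine le_of_eq ?_
        have : (0:ℝ) < d := by linarith
        field_simp)
    rw [show 2 * (y / 2) = y by ring] at key
    have k2 : ‖(fc d lam)^[n + 1] 0‖ * Real.log (2 * R / y ^ d) ≤ ‖(fc d lam)^[n + 1] 0‖ * (c2 * m) := by
      gcongr
    have k3 : ‖(fc d lam)^[n + 1] 0‖ * (c2 * m) ≤ y / (4 * (c2 * m)) * (c2 * m) := by gcongr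
    have k4 : y / (4 * (c2 * m)) * (c2 * m) = y / 4 := by field_simp
    have k5 : 9 / 32 * 2 * (y / 2) ≤ 9 / 32 * d * (y / 2) := by gcongr
    linarith

theorem fs_ball {R : ℝ} (hR0 : 0 ≤ R) (hR2 : R ≤ 2) :
    ∫⁻ z : ℂ in Metric.closedBall 0 R, ENNReal.ofReal (((1 + ‖z‖ ^ 2) ^ 2)⁻¹) ≤ ENNReal.ofReal (π * (4 / 5)) := by
  rw [← lintegral_indicator Metric.isClosed_closedBall.measurableSet]
  have e : (fun z : ℂ => (Metric.closedBall 0 R).indicator (fun z : ℂ => ENNReal.ofReal (((1 + ‖z‖ ^ 2) ^ 2)⁻¹)) z) =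
      fun z => (Set.Iic R).indicator (fun r => ENNReal.ofReal (((1 + r ^ 2) ^ 2)⁻¹)) ‖z‖ := by
    ext z
    simp [Set.indicator]
  rw [e, polar_radial (Measurable.indicator (by fun_prop) measurableSet_Iic)]
  have e2 : ∀ r : ℝ, ENNReal.ofReal r * (Set.Iic R).indicator (fun r => ENNReal.ofReal (((1 + r ^ 2) ^ 2)⁻¹)) r =
      (Set.Iic R).indicator (fun r => ENNReal.ofReal (r * ((1 + r ^ 2) ^ 2)⁻¹)) r := by
    intro r
    by_cases hr : r ∈ Set.Iic R
    · rw [Set.indicator_of_mem hr, Set.indicator_of_mem hr, ← ENNReal.ofReal_mul' (by positivity)]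
    · rw [Set.indicator_of_notMem hr, Set.indicator_of_notMem hr, mul_zero]
  simp_rw [e2]
  rw [setLIntegral_indicator measurableSet_Iic, Set.inter_comm, Set.Ioi_inter_Iic]
  have hder : ∀ r : ℝ, HasDerivAt (fun r : ℝ => -(1 / 2) * (1 + r ^ 2)⁻¹) (r * ((1 + r ^ 2) ^ 2)⁻¹) r := by
    intro r
    have h1 : HasDerivAt (fun r : ℝ => 1 + r ^ 2) (2 * r) r := by
      simpa using (hasDerivAt_pow 2 r).const_add 1
    have := (h1.inv (by positivity)).const_mul (-(1 / 2 : ℝ))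
    refine this.congr_deriv ?_
    field_simp
  have hcont : Continuous fun r : ℝ => r * ((1 + r ^ 2) ^ 2)⁻¹ := by
    refine continuous_id.mul (Continuous.inv₀ (by fun_prop) fun r => by positivity)
  have hintegral := intervalIntegral.integral_eq_sub_of_hasDerivAt (a := 0) (b := R) (fun r _ => hder r)
    (hcont.intervalIntegrable _ _)
  rw [intervalIntegral.integral_of_le hR0] at hintegral
  rw [← ofReal_integral_eq_lintegral_ofReal (hcont.integrableOn_Ioc), hintegral,
    ← ENNReal.ofReal_mul (by positivity)]
  · refine ENNReal.ofReal_le_ofReal ?_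
    have h5 : (1 / 5 : ℝ) ≤ (1 + R ^ 2)⁻¹ := by
      rw [one_div]; exact inv_anti₀ (by positivity) (by nlinarith)
    have : 2 * π * (-(1 / 2) * (1 + R ^ 2)⁻¹ - -(1 / 2) * (1 + 0 ^ 2)⁻¹) = π * (1 - (1 + R ^ 2)⁻¹) := by
      norm_num; ring
    rw [this]
    gcongr
    linarith
  · filter_upwards [ae_restrict_mem measurableSet_Ioc] with r hr
    have := hr.1.le
    simp only [Pi.zero_apply]
    positivity

theorem fs_ball_integral {R : ℝ} (hR0 : 0 ≤ R) (hR2 : R ≤ 2) :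
    IntegrableOn (fun z : ℂ => ((1 + ‖z‖ ^ 2) ^ 2)⁻¹) (Metric.closedBall 0 R) ∧
    ∫ z : ℂ in Metric.closedBall 0 R, ((1 + ‖z‖ ^ 2) ^ 2)⁻¹ ≤ π * (4 / 5) := by
  have hcont : Continuous fun z : ℂ => ((1 + ‖z‖ ^ 2) ^ 2)⁻¹ :=
    Continuous.inv₀ (by fun_prop) fun r => by positivity
  have hi : IntegrableOn (fun z : ℂ => ((1 + ‖z‖ ^ 2) ^ 2)⁻¹) (Metric.closedBall 0 R) :=
    hcont.continuousOn.integrableOn_compact (isCompact_closedBall _ _)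
  refine ⟨hi, ?_⟩
  rw [← ENNReal.ofReal_le_ofReal_iff (by positivity), ofReal_integral_eq_lintegral_ofReal hi]
  · exact fs_ball hR0 hR2
  · exact Filter.Eventually.of_forall fun z => by positivity

theorem step_bound (d : ℕ) (hd : 1 < d) (lam x : ℂ) :
    |1 / 2 * Real.log (1 + ‖x ^ d + lam‖ ^ 2) - d * (1 / 2 * Real.log (1 + ‖x‖ ^ 2))| ≤
      1 / 2 * Real.log (2 ^ d * (1 + ‖lam‖ ^ 2)) := by
  set y := x ^ d + lam with hy
  have h2d : (2:ℝ) ≤ 2 ^ d := by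
    calc (2:ℝ) = 2 ^ 1 := by norm_num
      _ ≤ 2 ^ d := pow_le_pow_right₀ (by norm_num) (by omega)
  have hxd : ‖x ^ d‖ ^ 2 = (‖x‖ ^ 2) ^ d := by rw [norm_pow, ← pow_mul, ← pow_mul, mul_comm]
  have hl : (0:ℝ) ≤ ‖lam‖ ^ 2 := by positivity
  have hy2 : ‖y‖ ^ 2 ≤ 2 * (‖x‖ ^ 2) ^ d + 2 * ‖lam‖ ^ 2 := by
    have : ‖y‖ ≤ ‖x ^ d‖ + ‖lam‖ := norm_add_le _ _
    rw [← hxd]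
    nlinarith [sq_nonneg (‖x ^ d‖ - ‖lam‖), norm_nonneg y]
  have hx2 : (‖x‖ ^ 2) ^ d ≤ 2 * ‖y‖ ^ 2 + 2 * ‖lam‖ ^ 2 := by
    have : ‖x ^ d‖ ≤ ‖y‖ + ‖lam‖ := by
      calc ‖x ^ d‖ = ‖y - lam‖ := by rw [hy, add_sub_cancel_right]
        _ ≤ _ := norm_sub_le _ _
    rw [← hxd]
    nlinarith [sq_nonneg (‖y‖ - ‖lam‖), norm_nonneg (x ^ d)]
  have hp1 : 1 + (‖x‖ ^ 2) ^ d ≤ (1 + ‖x‖ ^ 2) ^ d := by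
    have := pow_add_pow_le (x := (1:ℝ)) (y := ‖x‖ ^ 2) (n := d) (by norm_num) (by positivity) (by omega)
    simpa using this
  have hp2 : (1 + ‖x‖ ^ 2) ^ d ≤ 2 ^ (d - 1) * (1 + (‖x‖ ^ 2) ^ d) := by
    have := add_pow_le (a := (1:ℝ)) (b := ‖x‖ ^ 2) (by norm_num) (by positivity) d
    simpa using this
  have h2d' : (2:ℝ) ^ d = 2 ^ (d - 1) * 2 := by rw [← pow_succ]; congr 1; omega
  have A1 : 1 + ‖y‖ ^ 2 ≤ (2 ^ d * (1 + ‖lam‖ ^ 2)) * (1 + ‖x‖ ^ 2) ^ d := by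
    have hpos : 0 ≤ (‖x‖ ^ 2) ^ d := by positivity
    calc 1 + ‖y‖ ^ 2 ≤ (2 * (1 + ‖lam‖ ^ 2)) * (1 + (‖x‖ ^ 2) ^ d) := by nlinarith
      _ ≤ _ := by gcongr
  have A2 : (1 + ‖x‖ ^ 2) ^ d ≤ (2 ^ d * (1 + ‖lam‖ ^ 2)) * (1 + ‖y‖ ^ 2) := by
    calc (1 + ‖x‖ ^ 2) ^ d ≤ 2 ^ (d - 1) * (1 + (‖x‖ ^ 2) ^ d) := hp2
      _ ≤ 2 ^ (d - 1) * (2 * (1 + ‖lam‖ ^ 2) * (1 + ‖y‖ ^ 2)) := by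
          gcongr
          nlinarith [mul_nonneg hl (sq_nonneg ‖y‖)]
      _ = _ := by rw [h2d']; ring
  have B1 := Real.log_le_log (by positivity) A1
  have B2 := Real.log_le_log (by positivity) A2
  rw [Real.log_mul (by positivity) (by positivity), Real.log_pow] at B1
  rw [Real.log_mul (by positivity) (by positivity), Real.log_pow] at B2
  rw [abs_le]
  constructor <;> linarith

theorem gI_bound {d : ℕ} (hd : 1 < d) {gI : ℂ → ℝ}
    (hgI : ∀ lam : ℂ, Filter.Tendsto
      (fun k : ℕ => (1 / 2) * Real.log (1 + ‖(fc d lam)^[k] 0‖ ^ 2) / (d : ℝ) ^ (k - 1))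
      Filter.atTop (nhds (gI lam))) (lam : ℂ) (n : ℕ) :
    |(d:ℝ) ^ n * gI lam - 1 / 2 * Real.log (1 + ‖(fc d lam)^[n + 1] 0‖ ^ 2)| ≤
      1 / 2 * Real.log (2 ^ d * (1 + ‖lam‖ ^ 2)) := by
  set b : ℕ → ℝ := fun k => 1 / 2 * Real.log (1 + ‖(fc d lam)^[k] 0‖ ^ 2) with hb
  set c := 1 / 2 * Real.log (2 ^ d * (1 + ‖lam‖ ^ 2)) with hc
  have hd2 : (2:ℝ) ≤ d := by exact_mod_cast hd
  have hstep : ∀ k, |b (k + 1) - d * b k| ≤ c := by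
    intro k
    have := step_bound d hd lam ((fc d lam)^[k] 0)
    rwa [← fc_succ] at this
  have hc0 : 0 ≤ c := (abs_nonneg _).trans (hstep 0)
  have htel : ∀ k, |b (n + 1 + k) - d ^ k * b (n + 1)| ≤ c * (d ^ k - 1) := by
    intro k
    induction k with
    | zero => simp
    | succ k ih =>
      have h1 := hstep (n + 1 + k)
      have h2 : |(d:ℝ) * (b (n + 1 + k) - d ^ k * b (n + 1))| ≤ d * (c * (d ^ k - 1)) := by
        rw [abs_mul, abs_of_nonneg (by positivity : (0:ℝ) ≤ d)]
        gcongr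
      have h3 := abs_add_le (b (n + 1 + k + 1) - d * b (n + 1 + k)) ((d:ℝ) * (b (n + 1 + k) - d ^ k * b (n + 1)))
      have e : b (n + 1 + k + 1) - d * b (n + 1 + k) + (d:ℝ) * (b (n + 1 + k) - d ^ k * b (n + 1)) =
          b (n + 1 + (k + 1)) - d ^ (k + 1) * b (n + 1) := by rw [← add_assoc, pow_succ]; ring
      rw [e] at h3
      refine h3.trans ((add_le_add h1 h2).trans ?_)
      rw [pow_succ]
      nlinarith
  have hlim := ((hgI lam).comp (Filter.tendsto_add_atTop_nat (n + 1))).const_mul ((d:ℝ) ^ n)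
  have hlim2 := (hlim.sub_const (b (n + 1))).abs
  refine le_of_tendsto hlim2 (Filter.Eventually.of_forall fun k => ?_)
  have e : (d:ℝ) ^ n * ((fun k : ℕ => (1 / 2) * Real.log (1 + ‖(fc d lam)^[k] 0‖ ^ 2) / (d : ℝ) ^ (k - 1)) ∘
      fun a => a + (n + 1)) k - b (n + 1) = (b (n + 1 + k) - d ^ k * b (n + 1)) / d ^ k := by
    simp only [Function.comp]
    rw [show k + (n + 1) - 1 = n + k by omega, show k + (n + 1) = n + 1 + k by omega, pow_add]
    have : (0:ℝ) < d := by linarith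
    have hb2 : b (n + 1 + k) = 1 / 2 * Real.log (1 + ‖(fc d lam)^[n + 1 + k] 0‖ ^ 2) := rfl
    rw [← hb2]
    field_simp
  rw [e, abs_div, abs_of_pos (by positivity : (0:ℝ) < d ^ k), div_le_iff₀ (by positivity)]
  refine (htel k).trans ?_
  gcongr
  linarith

theorem log_bound {x : ℝ} (hx : 0 ≤ x) :
    |1 / 2 * Real.log (1 + x ^ 2) - Real.log x| ≤ 1 / 2 * Real.log 2 + max 0 (-Real.log x) := by
  have hl2 : 0 < Real.log 2 := Real.log_pos (by norm_num)
  rcases hx.eq_or_lt with rfl | hx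
  · simp; positivity
  rcases le_total x 1 with h | h
  · have h1 : 0 ≤ Real.log (1 + x ^ 2) := Real.log_nonneg (by nlinarith)
    have h2 : Real.log (1 + x ^ 2) ≤ Real.log 2 := Real.log_le_log (by positivity) (by nlinarith)
    have h3 : Real.log x ≤ 0 := Real.log_nonpos hx.le h
    rw [max_eq_right (by linarith), abs_le]
    constructor <;> linarith
  · have h1 : 2 * Real.log x ≤ Real.log (1 + x ^ 2) := by
      have : Real.log (x ^ 2) = 2 * Real.log x := by rw [Real.log_pow]; norm_num
      rw [← this]
      exact Real.log_le_log (by positivity) (by linarith)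
    have h2 : Real.log (1 + x ^ 2) ≤ Real.log 2 + 2 * Real.log x := by
      have : Real.log (2 * x ^ 2) = Real.log 2 + 2 * Real.log x := by
        rw [Real.log_mul (by norm_num) (by positivity), Real.log_pow]; norm_num
      rw [← this]
      exact Real.log_le_log (by positivity) (by nlinarith)
    have h3 := le_max_left 0 (-Real.log x)
    rw [abs_le]
    constructor <;> linarith

theorem half_log_le {x : ℝ} (hx : 1 ≤ x) : 1 / 2 * Real.log x ≤ x ^ (1 / 2 : ℝ) := by
  have h : 0 < x ^ (1 / 2 : ℝ) := by positivity
  have := Real.log_le_sub_one_of_pos h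
  rw [Real.log_rpow (by linarith)] at this
  linarith

theorem pointwise {d : ℕ} (hd : 1 < d) {gI : ℂ → ℝ}
    (hgI : ∀ lam : ℂ, Filter.Tendsto
      (fun k : ℕ => (1 / 2) * Real.log (1 + ‖(fc d lam)^[k] 0‖ ^ 2) / (d : ℝ) ^ (k - 1))
      Filter.atTop (nhds (gI lam))) (lam : ℂ) (n : ℕ) :
    |Real.log ‖(fc d lam)^[n + 1] 0‖ - (d:ℝ) ^ n * gI lam| ≤
      (d + 2) * (1 + ‖lam‖ ^ 2) ^ (1 / 2 : ℝ) + max 0 (-Real.log ‖(fc d lam)^[n + 1] 0‖) := by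
  have h1 := gI_bound hd hgI lam n
  have h2 := log_bound (norm_nonneg ((fc d lam)^[n + 1] 0))
  set b := 1 / 2 * Real.log (1 + ‖(fc d lam)^[n + 1] 0‖ ^ 2)
  have h3 : |Real.log ‖(fc d lam)^[n + 1] 0‖ - (d:ℝ) ^ n * gI lam| ≤
      |b - Real.log ‖(fc d lam)^[n + 1] 0‖| + |(d:ℝ) ^ n * gI lam - b| := by
    have h := abs_sub_le (Real.log ‖(fc d lam)^[n + 1] 0‖) b ((d:ℝ) ^ n * gI lam)
    rw [abs_sub_comm _ b, abs_sub_comm b ((d:ℝ) ^ n * gI lam)] at h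
    exact h
  have hone : 1 ≤ (1 + ‖lam‖ ^ 2) ^ (1 / 2 : ℝ) :=
    Real.one_le_rpow (by nlinarith [norm_nonneg lam]) (by norm_num)
  have h4 := half_log_le (x := 1 + ‖lam‖ ^ 2) (by nlinarith [norm_nonneg lam])
  rw [Real.log_mul (by positivity) (by positivity), Real.log_pow] at h1
  have hl2 : Real.log 2 < 1 := by linarith [Real.log_two_lt_d9]
  have hl20 : 0 < Real.log 2 := Real.log_pos (by norm_num)
  have hd0 : (0:ℝ) ≤ d := by positivity
  have h5 : d * Real.log 2 ≤ d := by nlinarith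
  have h6 : (d:ℝ) ≤ d * (1 + ‖lam‖ ^ 2) ^ (1 / 2 : ℝ) := by nlinarith
  nlinarith

theorem dominate {d : ℕ} (hd : 1 < d) {gI : ℂ → ℝ}
    (hgI : ∀ lam : ℂ, Filter.Tendsto
      (fun k : ℕ => (1 / 2) * Real.log (1 + ‖(fc d lam)^[k] 0‖ ^ 2) / (d : ℝ) ^ (k - 1))
      Filter.atTop (nhds (gI lam))) :
    ∃ C : ℝ, ∀ n : ℕ, ∃ G : ℂ → ℝ, Integrable G ∧
      (∀ lam, ((d:ℝ) - 1) * |Real.log ‖(fc d lam)^[n + 1] 0‖ - (d:ℝ) ^ n * gI lam| /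
        (1 + ‖lam‖ ^ 2) ^ 2 ≤ G lam) ∧
      π⁻¹ * ∫ lam, G lam ≤ 2 * Real.log d * (n + 1) + C := by
  obtain ⟨R, hR1, hR2, hR⟩ := exists_R hd
  obtain ⟨C₀, hC₀, hδ⟩ := exists_delta hd
  have hd2 : (2:ℝ) ≤ d := by exact_mod_cast hd
  have hR0 : 0 ≤ R := by linarith
  have hI1 : Integrable fun z : ℂ => (1 + ‖z‖ ^ 2) ^ (-(3:ℝ) / 2) :=
    integrable_rpow_neg_one_add_norm_sq (by simp [Complex.finrank_real_complex]; norm_num)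
  set H := ∫ z : ℂ, (1 + ‖z‖ ^ 2) ^ (-(3:ℝ) / 2) with hH
  obtain ⟨hI2, hI2'⟩ := fs_ball_integral hR0 hR2
  have hld : 0 < Real.log d := Real.log_pos (by linarith)
  set ε : ℝ := Real.log d / (4 * (d - 1)) with hε
  have hε0 : 0 < ε := div_pos hld (by linarith)
  refine ⟨(d - 1) * (π⁻¹ * ((d + 2) * H) + 4 / 5 * (C₀ + 2 * (- Real.log ε)) + 20), fun n => ?_⟩
  obtain ⟨δ, hδ0, hδ1, hδl, hδd⟩ := hδ n
  have hpl := poly_log (critPoly d (n + 1)) hδ0 hδd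
  simp only [critPoly_eval] at hpl
  set F : ℂ → ℂ := fun lam => (fc d lam)^[n + 1] 0 with hF
  have hFc : Continuous F := by
    have : F = fun lam => (critPoly d (n + 1)).eval lam := by ext lam; rw [critPoly_eval]
    rw [this]; exact Polynomial.continuous _
  set S : Set ℂ := {lam | ‖F lam‖ < δ} with hS
  have hSm : MeasurableSet S := measurableSet_lt hFc.norm.measurable measurable_const
  have hSR : S ⊆ Metric.closedBall 0 R := by
    intro lam hlam
    have hlam : ‖F lam‖ < δ := hlam
    have := (orbit_bound hd hR1 hR (lam := lam) (n := n) (by linarith)).1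
    simpa using this
  set J : ℂ → ℝ := fun lam => Real.log (δ / ‖F lam‖) with hJ
  have hJm : Measurable J := by
    have := hFc.measurable
    fun_prop
  have hJ0 : ∀ lam ∈ S, 0 ≤ J lam := by
    intro lam hlam
    have hlam : ‖F lam‖ < δ := hlam
    rcases (norm_nonneg (F lam)).eq_or_lt with h | h
    · simp [hJ, ← h]
    · exact Real.log_nonneg (by rw [le_div_iff₀ h]; linarith)
  have hvol : 5 * volume S ≤ ENNReal.ofReal (20 * π) := by
    calc 5 * volume S ≤ 5 * volume (Metric.closedBall (0:ℂ) R) := by gcongr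
      _ = ENNReal.ofReal (5 * (R ^ 2 * π)) := by
          rw [Complex.volume_closedBall, ENNReal.ofReal_mul (by norm_num), ENNReal.ofReal_mul (by positivity),
            ENNReal.ofReal_pow hR0]
          congr 1
          · simp
          · congr 1
            rw [← NNReal.coe_real_pi, ENNReal.ofReal_coe_nnreal]
      _ ≤ _ := by
          refine ENNReal.ofReal_le_ofReal ?_
          nlinarith [pi_pos, mul_nonneg pi_pos.le (by nlinarith : (0:ℝ) ≤ 4 - R ^ 2)]
  have hJl : ∫⁻ lam in S, ENNReal.ofReal (J lam) ≤ ENNReal.ofReal (20 * π) := hpl.trans hvol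
  have hJi : IntegrableOn J S := by
    refine ⟨hJm.aestronglyMeasurable, ?_⟩
    rw [hasFiniteIntegral_iff_ofReal]
    · exact hJl.trans_lt ENNReal.ofReal_lt_top
    · filter_upwards [ae_restrict_mem hSm] with lam hlam using hJ0 lam hlam
  have hJint : ∫ lam in S, J lam ≤ 20 * π := by
    rw [← ENNReal.ofReal_le_ofReal_iff (by positivity), ofReal_integral_eq_lintegral_ofReal hJi]
    · exact hJl
    · filter_upwards [ae_restrict_mem hSm] with lam hlam using hJ0 lam hlam
  set A := -Real.log δ with hA
  have hA0 : 0 ≤ A := by rw [hA]; linarith [Real.log_nonpos hδ0.le hδ1]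
  set B := Metric.closedBall (0:ℂ) R with hB
  have hBm : MeasurableSet B := Metric.isClosed_closedBall.measurableSet
  set D : ℂ → ℝ := fun z => ((1 + ‖z‖ ^ 2) ^ 2)⁻¹ with hD
  have hi1 := (hI1.const_mul ((d:ℝ) + 2))
  have hi2 := ((integrable_indicator_iff hBm).2 hI2).const_mul A
  have hi3 := (integrable_indicator_iff hSm).2 hJi
  refine ⟨fun lam => (d - 1) * (((d + 2) * (1 + ‖lam‖ ^ 2) ^ (-(3:ℝ) / 2) + A * B.indicator D lam) +
    S.indicator J lam), ((hi1.add hi2).add hi3).const_mul _, fun lam => ?_, ?_⟩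
  · rw [mul_div_assoc]
    refine mul_le_mul_of_nonneg_left ?_ (by linarith)
    have hw : 1 ≤ (1 + ‖lam‖ ^ 2) ^ 2 := one_le_pow₀ (by nlinarith [norm_nonneg lam])
    have hD0 : 0 ≤ D lam := by simp only [hD]; positivity
    have hD1 : D lam ≤ 1 := inv_le_one_of_one_le₀ hw
    have hpt := pointwise hd hgI lam n
    have hL : max 0 (-Real.log ‖F lam‖) * D lam ≤ A * B.indicator D lam + S.indicator J lam := by
      by_cases hs : lam ∈ S
      · rw [Set.indicator_of_mem hs, Set.indicator_of_mem (hSR hs)]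
        have hJs := hJ0 lam hs
        have : max 0 (-Real.log ‖F lam‖) ≤ A + J lam := by
          refine max_le (by linarith) ?_
          rcases (norm_nonneg (F lam)).eq_or_lt with h | h
          · rw [← h]; simp; linarith
          · simp only [hA, hJ]
            rw [Real.log_div hδ0.ne' h.ne']; linarith
        nlinarith
      · rw [Set.indicator_of_notMem hs, add_zero]
        have hs' : δ ≤ ‖F lam‖ := not_lt.1 hs
        by_cases hb : lam ∈ B
        · rw [Set.indicator_of_mem hb]
          gcongr
          refine max_le hA0 ?_
          rw [hA]
          exact neg_le_neg (Real.log_le_log hδ0 hs')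
        · rw [Set.indicator_of_notMem hb, mul_zero]
          have h1 : 1 ≤ ‖F lam‖ := by
            by_contra h
            push Not at h
            refine hb ?_
            have := (orbit_bound hd hR1 hR (lam := lam) (n := n) (by linarith)).1
            simpa [hB] using this
          rw [max_eq_left (by linarith [Real.log_nonneg h1]), zero_mul]
    have hrp : (1 + ‖lam‖ ^ 2) ^ (1 / 2 : ℝ) * D lam = (1 + ‖lam‖ ^ 2) ^ (-(3:ℝ) / 2) := by
      have hp : 0 < 1 + ‖lam‖ ^ 2 := by positivity
      have : D lam = (1 + ‖lam‖ ^ 2) ^ (-2 : ℝ) := by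
        simp only [hD]
        rw [Real.rpow_neg hp.le]; norm_num
      rw [this, ← Real.rpow_add hp]
      norm_num
    calc _ = |Real.log ‖F lam‖ - (d:ℝ) ^ n * gI lam| * D lam := by rw [div_eq_mul_inv]
      _ ≤ ((d + 2) * (1 + ‖lam‖ ^ 2) ^ (1 / 2 : ℝ) + max 0 (-Real.log ‖F lam‖)) * D lam := by gcongr
      _ = (d + 2) * ((1 + ‖lam‖ ^ 2) ^ (1 / 2 : ℝ) * D lam) + max 0 (-Real.log ‖F lam‖) * D lam := by ring
      _ ≤ _ := by rw [hrp]; linarith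
  · have hi12 : Integrable (fun x : ℂ => ((d:ℝ) + 2) * (1 + ‖x‖ ^ 2) ^ (-(3:ℝ) / 2) +
        A * B.indicator D x) := hi1.add hi2
    rw [integral_const_mul, integral_add hi12 hi3, integral_add hi1 hi2, integral_const_mul,
      integral_const_mul, integral_indicator hBm, integral_indicator hSm]
    have hpi := pi_pos
    have k1 : π⁻¹ * (A * ∫ z in B, D z) ≤ 4 / 5 * A := by
      calc π⁻¹ * (A * ∫ z in B, D z) ≤ π⁻¹ * (A * (π * (4 / 5))) := by gcongr
        _ = _ := by field_simp
    have k2 : π⁻¹ * ∫ z in S, J z ≤ 20 := by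
      calc π⁻¹ * ∫ z in S, J z ≤ π⁻¹ * (20 * π) := by gcongr
        _ = _ := by field_simp
    have hm0 : (0:ℝ) < n + 1 := by positivity
    have k3 : Real.log (n + 1) ≤ ε * (n + 1) - Real.log ε := by
      have := Real.log_le_sub_one_of_pos (mul_pos hε0 hm0)
      rw [Real.log_mul hε0.ne' hm0.ne'] at this
      linarith
    have k4 : Real.log (2 * d) ≤ 2 * Real.log d := by
      have : Real.log ((d:ℝ) ^ 2) = 2 * Real.log d := by rw [Real.log_pow]; norm_num
      rw [← this]
      exact Real.log_le_log (by positivity) (by nlinarith)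
    have hd1 : (0:ℝ) < d - 1 := by linarith
    have k5 : (d - 1) * A ≤ (n + 1) * (2 * Real.log d) + (d - 1) * (C₀ + 2 * (-Real.log ε)) +
        (n + 1) * (Real.log d / 2) := by
      calc (d - 1) * A ≤ (d - 1) * ((n + 1) * Real.log (2 * d) / (d - 1) + C₀ + 2 * (ε * (n + 1) - Real.log ε)) := by
            gcongr
            linarith
        _ = (n + 1) * Real.log (2 * d) + (d - 1) * (C₀ + 2 * (-Real.log ε)) + (n + 1) * (Real.log d / 2) := by
            rw [hε]; field_simp; ring
        _ ≤ _ := by gcongr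
    calc _ = (d - 1) * (π⁻¹ * ((d + 2) * H) + π⁻¹ * (A * ∫ z in B, D z) + π⁻¹ * ∫ z in S, J z) := by
          rw [hH]; ring
      _ ≤ (d - 1) * (π⁻¹ * ((d + 2) * H) + 4 / 5 * A + 20) := by gcongr
      _ = (d - 1) * (π⁻¹ * ((d + 2) * H) + 20) + 4 / 5 * ((d - 1) * A) := by ring
      _ ≤ (d - 1) * (π⁻¹ * ((d + 2) * H) + 20) + 4 / 5 * ((n + 1) * (2 * Real.log d) + (d - 1) * (C₀ + 2 * (-Real.log ε)) +
        (n + 1) * (Real.log d / 2)) := by gcongr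
      _ = _ := by ring

theorem statement16 (d : ℕ) (hd : 1 < d) (gI : ℂ → ℝ)
    (hgI : ∀ lam : ℂ, Filter.Tendsto
      (fun k : ℕ => (1 / 2) * Real.log (1 + ‖(fc d lam)^[k] 0‖ ^ 2) / (d : ℝ) ^ (k - 1))
      Filter.atTop (nhds (gI lam))) :
    ∃ C : ℝ, 0 < C ∧ ∀ n : ℕ, 1 ≤ n →
      π⁻¹ * (∫ lam : ℂ,
          |((d : ℝ) - 1) *
              (∑ m ∈ n.divisors,
                (ArithmeticFunction.moebius (n / m) : ℝ) * Real.log ‖(fc d lam)^[m] 0‖)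
            - ((d : ℝ) - 1) / d * (nu d n : ℝ) * gI lam| / (1 + ‖lam‖ ^ 2) ^ 2)
        ≤ (2 * Real.log d) * (∑ m ∈ n.divisors, (m : ℝ)) + C * n.divisors.card := by
  obtain ⟨C, hC⟩ := dominate hd hgI
  choose G hGi hGb hGint using hC
  refine ⟨max C 1, by positivity, fun n hn => ?_⟩
  have hd2 : (2:ℝ) ≤ d := by exact_mod_cast hd
  have hd0 : (d:ℝ) ≠ 0 := by linarith
  have hm1 : ∀ m ∈ n.divisors, m - 1 + 1 = m := fun m hm => by
    have := Nat.pos_of_mem_divisors hm; omega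
  have hle : ∀ lam : ℂ, |((d : ℝ) - 1) *
              (∑ m ∈ n.divisors,
                (ArithmeticFunction.moebius (n / m) : ℝ) * Real.log ‖(fc d lam)^[m] 0‖)
            - ((d : ℝ) - 1) / d * (nu d n : ℝ) * gI lam| / (1 + ‖lam‖ ^ 2) ^ 2 ≤
            ∑ m ∈ n.divisors, G (m - 1) lam := by
    intro lam
    have e : ((d : ℝ) - 1) * (∑ m ∈ n.divisors,
                (ArithmeticFunction.moebius (n / m) : ℝ) * Real.log ‖(fc d lam)^[m] 0‖)
            - ((d : ℝ) - 1) / d * (nu d n : ℝ) * gI lam =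
        ∑ m ∈ n.divisors, (ArithmeticFunction.moebius (n / m) : ℝ) *
          (((d : ℝ) - 1) * (Real.log ‖(fc d lam)^[m] 0‖ - (d:ℝ) ^ (m - 1) * gI lam)) := by
      rw [nu]
      push_cast
      rw [Finset.mul_sum, Finset.mul_sum, Finset.sum_mul, ← Finset.sum_sub_distrib]
      refine Finset.sum_congr rfl fun m hm => ?_
      have : (d:ℝ) ^ m = d ^ (m - 1) * d := by rw [← pow_succ, hm1 m hm]
      rw [this]
      field_simp
    rw [e]
    have hw : 0 < (1 + ‖lam‖ ^ 2) ^ 2 := by positivity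
    calc _ ≤ (∑ m ∈ n.divisors, ((d : ℝ) - 1) * |Real.log ‖(fc d lam)^[m] 0‖ - (d:ℝ) ^ (m - 1) * gI lam|) /
          (1 + ‖lam‖ ^ 2) ^ 2 := by
          gcongr
          refine (Finset.abs_sum_le_sum_abs _ _).trans (Finset.sum_le_sum fun m hm => ?_)
          rw [abs_mul, abs_mul, abs_of_nonneg (by linarith : (0:ℝ) ≤ d - 1)]
          refine mul_le_of_le_one_left (mul_nonneg (by linarith) (abs_nonneg _)) ?_
          have := ArithmeticFunction.abs_moebius_le_one (n := n / m)
          exact_mod_cast this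
      _ = ∑ m ∈ n.divisors, ((d : ℝ) - 1) * |Real.log ‖(fc d lam)^[m] 0‖ - (d:ℝ) ^ (m - 1) * gI lam| /
          (1 + ‖lam‖ ^ 2) ^ 2 := Finset.sum_div _ _ _
      _ ≤ _ := by
          refine Finset.sum_le_sum fun m hm => ?_
          have := hGb (m - 1) lam
          rwa [hm1 m hm] at this
  have hmono := integral_mono_of_nonneg (μ := volume)
    (Filter.Eventually.of_forall fun lam => by positivity)
    (integrable_finsetSum n.divisors fun m _ => hGi (m - 1)) (Filter.Eventually.of_forall hle)
  calc _ ≤ π⁻¹ * ∫ lam, ∑ m ∈ n.divisors, G (m - 1) lam := by gcongr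
    _ = ∑ m ∈ n.divisors, π⁻¹ * ∫ lam, G (m - 1) lam := by
        rw [integral_finsetSum _ fun m _ => hGi (m - 1), Finset.mul_sum]
    _ ≤ ∑ m ∈ n.divisors, (2 * Real.log d * m + max C 1) := by
        refine Finset.sum_le_sum fun m hm => (hGint (m - 1)).trans ?_
        have : ((m - 1 : ℕ) : ℝ) + 1 = m := by exact_mod_cast hm1 m hm
        rw [this]
        gcongr
        exact le_max_left _ _
    _ = _ := by
        rw [Finset.sum_add_distrib, ← Finset.mul_sum, Finset.sum_const, nsmul_eq_mul]; ring
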